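/- arXiv:2012.02335 — 4 statements merged into one kernel-verified Lean document; each statement's English description precedes it below -/
import Mathlib

section
/- Let f : {-1,1}^n → {-1,1} be a Boolean function and let B ∈ F₂^{n×n} be an invertible matrix. Define f_B : {-1,1}^n → ℝ by prescribing its Fourier coefficients as f̂_B(α) = f̂(Bα) for all α ∈ F₂^n (identifying α with a subset of [n]). Then f_B takes values in {-1,1} and deg₂(f_B) = deg₂(f). -/
open scoped BigOperators
open scoped Classical

noncomputable section

namespace BoolFunc

/-- Real value of a hypercube coordinate: `true ↦ -1`, `false ↦ 1`. -/
def signv (b : Bool) : ℝ := if b then -1 else 1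

/-- Fourier coefficient `f̂(S)` of `f : {-1,1}ⁿ → ℝ`. -/
def fourierCoeff {n : ℕ} (f : (Fin n → Bool) → ℝ) (S : Finset (Fin n)) : ℝ :=
  (∑ x : Fin n → Bool, f x * ∏ i ∈ S, signv (x i)) / 2 ^ n

/-- Fourier support of `f`. -/
def fourierSupport {n : ℕ} (f : (Fin n → Bool) → ℝ) : Finset (Finset (Fin n)) :=
  Finset.univ.filter (fun S => fourierCoeff f S ≠ 0)

/-- Fourier sparsity `k(f)`. -/
def sparsity {n : ℕ} (f : (Fin n → Bool) → ℝ) : ℕ := (fourierSupport f).card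

/-- Indicator vector in `F₂ⁿ` of a subset of `[n]`. -/
def indicatorVec {n : ℕ} (S : Finset (Fin n)) : Fin n → ZMod 2 :=
  fun i => if i ∈ S then 1 else 0

/-- Fourier rank `r(f)`: the `F₂`-dimension of the span of the Fourier support. -/
def fourierRank {n : ℕ} (f : (Fin n → Bool) → ℝ) : ℕ :=
  Module.finrank (ZMod 2)
    ↥(Submodule.span (ZMod 2)
      (indicatorVec '' (fourierSupport f : Set (Finset (Fin n)))))

/-- Weight `δ(f) = Pr[f(x) = -1]`. -/
def weight {n : ℕ} (f : (Fin n → Bool) → ℝ) : ℝ :=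
  ((Finset.univ.filter (fun x : Fin n → Bool => f x = -1)).card : ℝ) / 2 ^ n

/-- Fourier max-supp-entropy `k'(f) = max_{S ∈ supp(f)} 1/|f̂(S)|`. -/
def maxSuppEntropy {n : ℕ} (f : (Fin n → Bool) → ℝ) : ℝ :=
  sSup ((fun S => 1 / |fourierCoeff f S|) '' (fourierSupport f : Set (Finset (Fin n))))

/-- Dimension of the span of `{S : |f̂(S)| ≥ 1/t}`. -/
def levelDim {n : ℕ} (f : (Fin n → Bool) → ℝ) (t : ℝ) : ℕ :=
  Module.finrank (ZMod 2)
    ↥(Submodule.span (ZMod 2)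
      (indicatorVec '' {S : Finset (Fin n) | 1 / t ≤ |fourierCoeff f S|}))

/-- Fourier max-rank-entropy `k''(f)`. -/
def maxRankEntropy {n : ℕ} (f : (Fin n → Bool) → ℝ) : ℝ :=
  sInf {t : ℝ | 0 < t ∧ levelDim f t = fourierRank f}

/-- `f` is Boolean-valued (takes values in `{-1,1}`). -/
def IsBooleanFunc {n : ℕ} (f : (Fin n → Bool) → ℝ) : Prop := ∀ x, f x = 1 ∨ f x = -1

/-- Coefficient of the monomial `∏_{i ∈ S} zᵢ` in the unique multilinear `F₂`-polynomial
representing `f` under the identification `-1 ↦ 1, 1 ↦ 0` of `{-1,1}` with `F₂`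
(a coordinate `xᵢ = true` stands for `-1`, i.e. for the bit `1`). -/
def f2Coeff {n : ℕ} (f : (Fin n → Bool) → ℝ) (S : Finset (Fin n)) : ZMod 2 :=
  ∑ x ∈ Finset.univ.filter (fun x : Fin n → Bool => ∀ i, x i = true → i ∈ S),
    (if f x = -1 then 1 else 0)

/-- The `F₂`-degree `deg₂(f)`. -/
def f2Degree {n : ℕ} (f : (Fin n → Bool) → ℝ) : ℕ :=
  (Finset.univ.filter (fun S : Finset (Fin n) => f2Coeff f S ≠ 0)).sup Finset.card

/-- The subset of `[n]` corresponding to a vector in `F₂ⁿ`. -/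
def vecToFinset {n : ℕ} (v : Fin n → ZMod 2) : Finset (Fin n) :=
  Finset.univ.filter (fun i => v i = 1)

lemma zmod_two_eq_zero_or_one (a : ZMod 2) : a = 0 ∨ a = 1 := by
  revert a
  decide

/-- The identification of the hypercube with `F₂ⁿ`, sending `true` to `1`. -/
def cubeEquiv (n : ℕ) : (Fin n → Bool) ≃ (Fin n → ZMod 2) where
  toFun x i := if x i then 1 else 0
  invFun v i := decide (v i = 1)
  left_inv x := by
    funext i
    cases h : x i <;> simp [h]
  right_inv v := by
    funext i
    rcases zmod_two_eq_zero_or_one (v i) with h | h <;> simp [h]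

/-- The nontrivial real character of `F₂`. -/
def chi (a : ZMod 2) : ℝ := if a = 1 then -1 else 1

lemma chi_add (a b : ZMod 2) : chi (a + b) = chi a * chi b := by
  rcases zmod_two_eq_zero_or_one a with rfl | rfl <;>
    rcases zmod_two_eq_zero_or_one b with rfl | rfl <;>
    simp [chi, CharTwo.add_self_eq_zero]

lemma chi_sum {ι : Type*} (s : Finset ι) (a : ι → ZMod 2) :
    chi (∑ i ∈ s, a i) = ∏ i ∈ s, chi (a i) := by
  induction s using Finset.induction_on with
  | empty => simp [chi]
  | insert i s hi ih => rw [Finset.sum_insert hi, Finset.prod_insert hi, chi_add, ih]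

lemma prod_signv_vecToFinset {n : ℕ} (α : Fin n → ZMod 2) (x : Fin n → Bool) :
    ∏ i ∈ vecToFinset α, signv (x i) = chi (α ⬝ᵥ cubeEquiv n x) := by
  rw [dotProduct, chi_sum, vecToFinset, Finset.prod_filter]
  refine Finset.prod_congr rfl fun i _ => ?_
  simp only [cubeEquiv, Equiv.coe_fn_mk]
  rcases zmod_two_eq_zero_or_one (α i) with h | h <;> cases x i <;> simp [chi, signv, h]

lemma vecToFinset_indicatorVec {n : ℕ} (S : Finset (Fin n)) :
    vecToFinset (indicatorVec S) = S := by
  ext i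
  simp [vecToFinset, indicatorVec]

lemma sum_prod_signv_mul_prod_signv {n : ℕ} (x y : Fin n → Bool) :
    ∑ S : Finset (Fin n), (∏ i ∈ S, signv (x i)) * ∏ i ∈ S, signv (y i) =
      if x = y then 2 ^ n else 0 := by
  have h : ∑ S : Finset (Fin n), (∏ i ∈ S, signv (x i)) * ∏ i ∈ S, signv (y i) =
      ∏ i, (1 + signv (x i) * signv (y i)) := by
    rw [Finset.prod_one_add, Finset.powerset_univ]
    simp only [Finset.prod_mul_distrib]
  rw [h]
  split_ifs with hxy
  · subst hxy
    have : ∀ i, 1 + signv (x i) * signv (x i) = 2 := fun i => by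
      cases x i <;> norm_num [signv]
    simp [this]
  · obtain ⟨i, hi⟩ := Function.ne_iff.mp hxy
    refine Finset.prod_eq_zero (Finset.mem_univ i) ?_
    revert hi
    cases x i <;> cases y i <;> simp [signv]

lemma fourier_inversion {n : ℕ} (f : (Fin n → Bool) → ℝ) (x : Fin n → Bool) :
    ∑ S, fourierCoeff f S * ∏ i ∈ S, signv (x i) = f x := by
  simp only [fourierCoeff, div_mul_eq_mul_div, ← Finset.sum_div, Finset.sum_mul, mul_assoc]
  rw [Finset.sum_comm]
  simp only [← Finset.mul_sum, sum_prod_signv_mul_prod_signv]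
  simp

lemma fourierCoeff_injective {n : ℕ} :
    Function.Injective (fourierCoeff : ((Fin n → Bool) → ℝ) → Finset (Fin n) → ℝ) :=
  fun f g h => funext fun x => by rw [← fourier_inversion f x, h, fourier_inversion]

/-- The linear automorphism `x ↦ B⁻ᵀ x` of the hypercube. -/
def cubeMap {n : ℕ} (B : Matrix (Fin n) (Fin n) (ZMod 2)) (hB : IsUnit B.det) :
    (Fin n → Bool) ≃ (Fin n → Bool) :=
  ((cubeEquiv n).trans
    { toFun := fun v => B⁻¹.transpose.mulVec v
      invFun := fun v => B.transpose.mulVec v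
      left_inv := fun v => by
        simp [Matrix.mulVec_mulVec, ← Matrix.transpose_mul, Matrix.nonsing_inv_mul B hB]
      right_inv := fun v => by
        simp [Matrix.mulVec_mulVec, ← Matrix.transpose_mul, Matrix.mul_nonsing_inv B hB] }).trans
    (cubeEquiv n).symm

lemma cubeEquiv_cubeMap {n : ℕ} (B : Matrix (Fin n) (Fin n) (ZMod 2)) (hB : IsUnit B.det)
    (x : Fin n → Bool) :
    cubeEquiv n (cubeMap B hB x) = B⁻¹.transpose.mulVec (cubeEquiv n x) := by
  simp [cubeMap]

lemma cubeEquiv_cubeMap_symm {n : ℕ} (B : Matrix (Fin n) (Fin n) (ZMod 2)) (hB : IsUnit B.det)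
    (x : Fin n → Bool) :
    cubeEquiv n ((cubeMap B hB).symm x) = B.transpose.mulVec (cubeEquiv n x) := by
  simp [cubeMap]

lemma fourierCoeff_comp_cubeMap {n : ℕ} (f : (Fin n → Bool) → ℝ)
    (B : Matrix (Fin n) (Fin n) (ZMod 2)) (hB : IsUnit B.det) (α : Fin n → ZMod 2) :
    fourierCoeff (f ∘ cubeMap B hB) (vecToFinset α) =
      fourierCoeff f (vecToFinset (B.mulVec α)) := by
  simp only [fourierCoeff, prod_signv_vecToFinset]
  congr 1
  refine Fintype.sum_equiv (cubeMap B hB) _ _ fun x => ?_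
  rw [cubeEquiv_cubeMap, Matrix.dotProduct_mulVec, Matrix.vecMul_transpose, Matrix.mulVec_mulVec,
    Matrix.nonsing_inv_mul B hB, Matrix.one_mulVec, Function.comp_apply]

/-- The support of a hypercube point. -/
def cubeSupport {n : ℕ} (x : Fin n → Bool) : Finset (Fin n) :=
  Finset.univ.filter (fun i => x i = true)

lemma cubeSupport_injective {n : ℕ} :
    Function.Injective (cubeSupport : (Fin n → Bool) → Finset (Fin n)) := fun x y h => by
  funext i
  rw [Bool.eq_iff_iff]
  simpa only [cubeSupport, Finset.mem_filter, Finset.mem_univ, true_and] using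
    Finset.ext_iff.mp h i

lemma cubeSupport_subset_iff {n : ℕ} {x : Fin n → Bool} {S : Finset (Fin n)} :
    cubeSupport x ⊆ S ↔ ∀ i, x i = true → i ∈ S := by
  simp [cubeSupport, Finset.subset_iff]

lemma prod_cubeEquiv {n : ℕ} (S : Finset (Fin n)) (x : Fin n → Bool) :
    ∏ i ∈ S, cubeEquiv n x i = if S ⊆ cubeSupport x then 1 else 0 := by
  simp only [cubeEquiv, Equiv.coe_fn_mk, Finset.prod_ite_zero, Finset.prod_const_one]
  simp only [cubeSupport, Finset.subset_iff, Finset.mem_filter, Finset.mem_univ, true_and]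

lemma card_Icc_cast_zmod_two {α : Type*} (s t : Finset α) :
    ((Finset.Icc s t).card : ZMod 2) = if s = t then 1 else 0 := by
  split_ifs with h
  · simp [h]
  · by_cases hst : s ⊆ t
    · rw [Finset.card_Icc_finset hst]
      have : t.card - s.card ≠ 0 :=
        (Nat.sub_pos_of_lt (Finset.card_lt_card (hst.ssubset_of_ne h))).ne'
      push_cast
      rw [show (2 : ZMod 2) = 0 from rfl, zero_pow this]
    · rw [Finset.Icc_eq_empty (by simpa using hst)]
      simp

/-- The multilinear `F₂`-polynomial represents `f`. -/
lemma sum_f2Coeff_mul_prod {n : ℕ} (f : (Fin n → Bool) → ℝ) (x : Fin n → Bool) :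
    ∑ S, f2Coeff f S * ∏ i ∈ S, cubeEquiv n x i = if f x = -1 then 1 else 0 := by
  have key : ∀ y : Fin n → Bool,
      ∑ S : Finset (Fin n),
        (if cubeSupport y ⊆ S then (1 : ZMod 2) else 0) * (if S ⊆ cubeSupport x then 1 else 0) =
          if y = x then 1 else 0 := fun y => by
    have h := card_Icc_cast_zmod_two (cubeSupport y) (cubeSupport x)
    simp only [cubeSupport_injective.eq_iff] at h
    rw [← h]
    simp only [ite_zero_mul_ite_zero, mul_one, Finset.sum_boole]
    congr 2
    refine Finset.ext fun S => ?_
    simp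
  calc _ = ∑ S : Finset (Fin n), ∑ y : Fin n → Bool, (if f y = -1 then (1 : ZMod 2) else 0) *
        ((if cubeSupport y ⊆ S then (1 : ZMod 2) else 0) *
          (if S ⊆ cubeSupport x then 1 else 0)) := by
        refine Finset.sum_congr rfl fun S _ => ?_
        rw [prod_cubeEquiv, f2Coeff, Finset.sum_filter, Finset.sum_mul]
        refine Finset.sum_congr rfl fun y _ => ?_
        simp only [cubeSupport_subset_iff (x := y)]
        split_ifs <;> simp
    _ = _ := by
        rw [Finset.sum_comm]
        simp only [← Finset.mul_sum, key]
        simp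

lemma exists_mvPolynomial_of_f2Degree {n : ℕ} (f : (Fin n → Bool) → ℝ) :
    ∃ P : MvPolynomial (Fin n) (ZMod 2), P.totalDegree ≤ f2Degree f ∧
      ∀ x, MvPolynomial.eval (cubeEquiv n x) P = if f x = -1 then 1 else 0 := by
  refine ⟨∑ S, MvPolynomial.C (f2Coeff f S) * ∏ i ∈ S, MvPolynomial.X i, ?_, fun x => ?_⟩
  · refine MvPolynomial.totalDegree_finsetSum_le fun S _ => ?_
    by_cases hS : f2Coeff f S = 0
    · simp [hS]
    · refine (MvPolynomial.totalDegree_mul _ _).trans ?_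
      rw [MvPolynomial.totalDegree_C, zero_add]
      refine (MvPolynomial.totalDegree_finsetProd _ _).trans ?_
      simp only [MvPolynomial.totalDegree_X, Finset.sum_const, smul_eq_mul, mul_one]
      exact Finset.le_sup (f := Finset.card) (by simpa using hS)
  · simp [map_sum, map_prod, sum_f2Coeff_mul_prod]

lemma sum_monomial_eq_zero {n : ℕ} (S : Finset (Fin n)) (m : Fin n →₀ ℕ) {i : Fin n}
    (hiS : i ∈ S) (hi : m i = 0) :
    ∑ x ∈ Finset.univ.filter (fun x : Fin n → Bool => ∀ i, x i = true → i ∈ S),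
      ∏ j, cubeEquiv n x j ^ m j = 0 := by
  refine Finset.sum_involution (fun x _ => Function.update x i (!x i)) ?_ ?_ ?_ ?_
  · intro x _
    have : ∏ j, cubeEquiv n (Function.update x i (!x i)) j ^ m j =
        ∏ j, cubeEquiv n x j ^ m j := by
      refine Finset.prod_congr rfl fun j _ => ?_
      by_cases hj : j = i
      · subst hj
        simp [hi]
      · simp [cubeEquiv, hj]
    rw [this, CharTwo.add_self_eq_zero]
  · intro x _ _ h
    have := congrFun h i
    simp at this
  · intro x hx
    simp only [Finset.mem_filter, Finset.mem_univ, true_and] at hx ⊢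
    intro j hj
    by_cases hji : j = i
    · exact hji ▸ hiS
    · exact hx j (by simpa [hji] using hj)
  · intro x _
    simp

lemma f2Degree_le_totalDegree {n : ℕ} (f : (Fin n → Bool) → ℝ) (P : MvPolynomial (Fin n) (ZMod 2))
    (hP : ∀ x, MvPolynomial.eval (cubeEquiv n x) P = if f x = -1 then 1 else 0) :
    f2Degree f ≤ P.totalDegree := by
  refine Finset.sup_le fun S hS => ?_
  by_contra! hlt
  refine (Finset.mem_filter.mp hS).2 ?_
  simp only [f2Coeff, ← hP, MvPolynomial.eval_eq']
  rw [Finset.sum_comm]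
  refine Finset.sum_eq_zero fun m hm => ?_
  have hcard : m.support.card < S.card := by
    refine lt_of_le_of_lt (le_trans ?_ (MvPolynomial.le_totalDegree hm)) hlt
    rw [Finset.card_eq_sum_ones, Finsupp.sum]
    exact Finset.sum_le_sum fun j hj => Nat.one_le_iff_ne_zero.mpr (Finsupp.mem_support_iff.mp hj)
  obtain ⟨i, hiS, hi⟩ := Finset.exists_mem_notMem_of_card_lt_card hcard
  rw [← Finset.mul_sum, sum_monomial_eq_zero S m hiS (Finsupp.notMem_support_iff.mp hi), mul_zero]

lemma totalDegree_bind₁_le_of_linear {σ τ R : Type*} [CommSemiring R]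
    (P : MvPolynomial σ R) (l : σ → MvPolynomial τ R) (hl : ∀ i, (l i).totalDegree ≤ 1) :
    (MvPolynomial.bind₁ l P).totalDegree ≤ P.totalDegree := by
  rw [MvPolynomial.bind₁, MvPolynomial.aeval_def, MvPolynomial.eval₂_eq]
  refine MvPolynomial.totalDegree_finsetSum_le fun m hm => ?_
  refine (MvPolynomial.totalDegree_mul _ _).trans ?_
  rw [MvPolynomial.algebraMap_eq, MvPolynomial.totalDegree_C, zero_add]
  refine (MvPolynomial.totalDegree_finsetProd _ _).trans
    (le_trans ?_ (MvPolynomial.le_totalDegree hm))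
  refine Finset.sum_le_sum fun i _ => (MvPolynomial.totalDegree_pow _ _).trans ?_
  exact (Nat.mul_le_mul_left _ (hl i)).trans_eq (mul_one _)

lemma f2Degree_comp_le {n : ℕ} (f : (Fin n → Bool) → ℝ) (e : (Fin n → Bool) → Fin n → Bool)
    (L : Matrix (Fin n) (Fin n) (ZMod 2))
    (he : ∀ x, cubeEquiv n (e x) = L.mulVec (cubeEquiv n x)) :
    f2Degree (f ∘ e) ≤ f2Degree f := by
  obtain ⟨P, hdeg, hP⟩ := exists_mvPolynomial_of_f2Degree f
  refine (f2Degree_le_totalDegree (f ∘ e) (MvPolynomial.bind₁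
    (fun i => ∑ j, MvPolynomial.C (L i j) * MvPolynomial.X j) P) fun x => ?_).trans
    ((totalDegree_bind₁_le_of_linear P _ fun i => ?_).trans hdeg)
  · rw [Function.comp_apply, ← hP, he, MvPolynomial.eval, MvPolynomial.eval₂Hom_bind₁]
    congr 2
    funext i
    simp [Matrix.mulVec, dotProduct]
  · refine MvPolynomial.totalDegree_finsetSum_le fun j _ => ?_
    refine (MvPolynomial.totalDegree_mul _ _).trans ?_
    simp

/-- **Claim.** If `B ∈ F₂^{n×n}` is invertible and `g` is the function whose Fourier
coefficients are `ĝ(α) = f̂(Bα)` for all `α ∈ F₂ⁿ`, then `g` is `{-1,1}`-valued and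
`deg₂(g) = deg₂(f)`. -/
theorem f2Degree_basis_change
    (n : ℕ) (hn : 0 < n) (f g : (Fin n → Bool) → ℝ) (hf : IsBooleanFunc f)
    (B : Matrix (Fin n) (Fin n) (ZMod 2)) (hB : IsUnit B.det)
    (hg : ∀ α : Fin n → ZMod 2,
      fourierCoeff g (vecToFinset α) = fourierCoeff f (vecToFinset (B.mulVec α))) :
    IsBooleanFunc g ∧ f2Degree g = f2Degree f := by
  obtain rfl : g = f ∘ cubeMap B hB := fourierCoeff_injective <| funext fun S => by
    rw [← vecToFinset_indicatorVec S, hg, fourierCoeff_comp_cubeMap]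
  refine ⟨fun x => hf _, le_antisymm
    (f2Degree_comp_le f _ _ (cubeEquiv_cubeMap B hB)) ?_⟩
  simpa [Function.comp_assoc] using
    f2Degree_comp_le (f ∘ cubeMap B hB) _ _ (cubeEquiv_cubeMap_symm B hB)

end BoolFunc

end
end

section
/- Let t ≥ 2 be a power of 2, let m ≥ 1 be an integer, and let g : {-1,1}^m → {-1,1} be a non-constant function for which there exists a non-empty set S ⊆ [m] with 0 ≠ |ĝ(S)| ≤ |ĝ(∅)|. Let f : {-1,1}^{log t + mt} → {-1,1} be f = AD_t ∘ₜ g (each of the t target variables replaced by a copy of g on its own fresh block of m variables). Then: r(f) = t·r(g) + log t; k(f) = 1 + t²·(k(g) − 1); k'(f) = t·k'(g); k''(f) = t·k''(g); and δ(f) = δ(g). -/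
open scoped BigOperators
open scoped Classical

noncomputable section

namespace BoolFunc

/-- `bin(x) ∈ [t]`, reading `-1` (i.e. `true`) as bit `1` and `1` (i.e. `false`) as bit `0`. -/
def binIdx (τ : ℕ) (v : Fin τ → Bool) : Fin (2 ^ τ) :=
  finFunctionFinEquiv (fun i => if v i then (1 : Fin 2) else 0)

/-- The composed Addressing function `AD_t ∘ₜ g`, where `t = 2^τ` and each of the `t` target
variables is replaced by a copy of `g` on its own fresh block of `m` variables. -/
def ADcomp (τ m : ℕ) (g : (Fin m → Bool) → ℝ) : (Fin (τ + 2 ^ τ * m) → Bool) → ℝ :=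
  fun x =>
    g (fun l =>
      x (Fin.natAdd τ (finProdFinEquiv
        (binIdx τ (fun i => x (Fin.castAdd (2 ^ τ * m) i)), l))))

/-- The character `χ_S`. -/
def character {n : ℕ} (S : Finset (Fin n)) (x : Fin n → Bool) : ℝ := ∏ i ∈ S, signv (x i)

lemma abs_signv (b : Bool) : |signv b| = 1 := by cases b <;> simp [signv]

lemma abs_character {n : ℕ} (S : Finset (Fin n)) (x : Fin n → Bool) : |character S x| = 1 := by
  simp [character, Finset.abs_prod, abs_signv]

lemma sum_character {n : ℕ} (S : Finset (Fin n)) :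
    ∑ x, character S x = if S = ∅ then (2 : ℝ) ^ n else 0 := by
  have h : ∑ x : Fin n → Bool, character S x =
      ∏ i : Fin n, ∑ b : Bool, if i ∈ S then signv b else 1 := by
    rw [Fintype.prod_sum]
    refine Finset.sum_congr rfl fun x _ => ?_
    rw [character, Fintype.prod_ite_mem]
  rw [h]
  split_ifs with hS
  · simp [hS]
  · obtain ⟨i, hi⟩ := Finset.nonempty_iff_ne_empty.mpr hS
    exact Finset.prod_eq_zero (Finset.mem_univ i) (by simp [hi, signv])

lemma sum_mul_character {n : ℕ} (f : (Fin n → Bool) → ℝ) (S : Finset (Fin n)) :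
    ∑ x, f x * character S x = 2 ^ n * fourierCoeff f S := by
  simp only [fourierCoeff, character]
  field_simp

/-- Coordinates of the composed function: address bits, then blocks of target variables. -/
def coordEquiv (τ m : ℕ) : Fin τ ⊕ (Fin (2 ^ τ) × Fin m) ≃ Fin (τ + 2 ^ τ * m) :=
  (Equiv.sumCongr (Equiv.refl _) finProdFinEquiv).trans finSumFinEquiv

/-- Functions of the coordinates, split into an address part and the blocks. -/
def splitEquiv (τ m : ℕ) (α : Type*) :
    (Fin τ → α) × (Fin (2 ^ τ) → Fin m → α) ≃ (Fin (τ + 2 ^ τ * m) → α) where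
  toFun p i := Sum.elim p.1 (fun q => p.2 q.1 q.2) ((coordEquiv τ m).symm i)
  invFun x := (fun i => x (coordEquiv τ m (Sum.inl i)),
    fun b l => x (coordEquiv τ m (Sum.inr (b, l))))
  left_inv p := by simp
  right_inv x := by
    funext i
    obtain ⟨j, rfl⟩ := (coordEquiv τ m).surjective i
    rcases j with j | j <;> simp

/-- The set of coordinates with address part `A` and block parts `U`. -/
def glue {τ m : ℕ} (A : Finset (Fin τ)) (U : Fin (2 ^ τ) → Finset (Fin m)) :
    Finset (Fin (τ + 2 ^ τ * m)) :=
  Finset.univ.filter fun i =>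
    Sum.elim (fun j => j ∈ A) (fun q => q.2 ∈ U q.1) ((coordEquiv τ m).symm i)

@[simp] lemma inl_mem_glue {τ m : ℕ} {A : Finset (Fin τ)} {U : Fin (2 ^ τ) → Finset (Fin m)}
    {i : Fin τ} : coordEquiv τ m (Sum.inl i) ∈ glue A U ↔ i ∈ A := by
  simp [glue]

@[simp] lemma inr_mem_glue {τ m : ℕ} {A : Finset (Fin τ)} {U : Fin (2 ^ τ) → Finset (Fin m)}
    {q : Fin (2 ^ τ) × Fin m} : coordEquiv τ m (Sum.inr q) ∈ glue A U ↔ q.2 ∈ U q.1 := by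
  simp [glue]

lemma glue_inj {τ m : ℕ} {A A' : Finset (Fin τ)} {U U' : Fin (2 ^ τ) → Finset (Fin m)} :
    glue A U = glue A' U' ↔ A = A' ∧ U = U' := by
  refine ⟨fun h => ⟨?_, ?_⟩, fun h => by rw [h.1, h.2]⟩
  · ext i
    rw [← inl_mem_glue (U := U), h, inl_mem_glue]
  · funext b
    ext l
    have h1 := inr_mem_glue (A := A) (U := U) (q := (b, l))
    rw [h, inr_mem_glue] at h1
    exact h1.symm

lemma exists_eq_glue {τ m : ℕ} (T : Finset (Fin (τ + 2 ^ τ * m))) :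
    ∃ A U, T = glue A U := by
  refine ⟨Finset.univ.filter fun i => coordEquiv τ m (Sum.inl i) ∈ T,
    fun b => Finset.univ.filter fun l => coordEquiv τ m (Sum.inr (b, l)) ∈ T, ?_⟩
  ext i
  obtain ⟨j, rfl⟩ := (coordEquiv τ m).surjective i
  rcases j with j | j <;> simp

lemma glue_empty {τ m : ℕ} : glue (∅ : Finset (Fin τ)) (fun _ => (∅ : Finset (Fin m))) = ∅ := by
  ext i
  obtain ⟨j, rfl⟩ := (coordEquiv τ m).surjective i
  rcases j with j | j <;> simp

lemma character_glue {τ m : ℕ} (A : Finset (Fin τ)) (U : Fin (2 ^ τ) → Finset (Fin m))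
    (a : Fin τ → Bool) (y : Fin (2 ^ τ) → Fin m → Bool) :
    character (glue A U) (splitEquiv τ m Bool (a, y)) =
      character A a * ∏ b, character (U b) (y b) := by
  rw [character, ← Fintype.prod_ite_mem, ← Equiv.prod_comp (coordEquiv τ m),
    Fintype.prod_sum_type, Fintype.prod_prod_type]
  simp [splitEquiv, character]

lemma ADcomp_splitEquiv {τ m : ℕ} (g : (Fin m → Bool) → ℝ)
    (a : Fin τ → Bool) (y : Fin (2 ^ τ) → Fin m → Bool) :
    ADcomp τ m g (splitEquiv τ m Bool (a, y)) = g (y (binIdx τ a)) := by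
  have h1 (i : Fin τ) : Fin.castAdd (2 ^ τ * m) i = coordEquiv τ m (Sum.inl i) := by
    simp [coordEquiv]
  have h2 (q : Fin (2 ^ τ) × Fin m) :
      Fin.natAdd τ (finProdFinEquiv q) = coordEquiv τ m (Sum.inr q) := by
    simp [coordEquiv]
  simp only [ADcomp, h1, h2]
  simp [splitEquiv]

lemma binIdx_bijective (τ : ℕ) : Function.Bijective (binIdx τ) := by
  refine finFunctionFinEquiv.bijective.comp
    (Function.Bijective.comp_left (g := fun b : Bool => if b then (1 : Fin 2) else 0) ?_)
  decide

lemma fourierCoeff_ADcomp_glue {τ m : ℕ} (g : (Fin m → Bool) → ℝ)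
    (A : Finset (Fin τ)) (U : Fin (2 ^ τ) → Finset (Fin m)) :
    fourierCoeff (ADcomp τ m g) (glue A U) =
      (∑ a, character A a * if ∀ c, c ≠ binIdx τ a → U c = ∅ then
        fourierCoeff g (U (binIdx τ a)) else 0) / 2 ^ τ := by
  have key (a : Fin τ → Bool) :
      ∑ y : Fin (2 ^ τ) → Fin m → Bool, g (y (binIdx τ a)) * ∏ b, character (U b) (y b) =
        2 ^ (2 ^ τ * m) * if ∀ c, c ≠ binIdx τ a → U c = ∅ then
          fourierCoeff g (U (binIdx τ a)) else 0 := by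
    set β := binIdx τ a
    have h1 : ∑ y : Fin (2 ^ τ) → Fin m → Bool, g (y β) * ∏ b, character (U b) (y b) =
        ∏ b, ∑ z, (if b = β then g z else 1) * character (U b) z := by
      rw [Fintype.prod_sum]
      refine Finset.sum_congr rfl fun y _ => ?_
      rw [Finset.prod_mul_distrib]
      simp
    rw [h1, ← Finset.mul_prod_erase _ _ (Finset.mem_univ β)]
    have h2 : ∏ b ∈ Finset.univ.erase β, ∑ z, (if b = β then g z else 1) * character (U b) z =
        ∏ b ∈ Finset.univ.erase β, if U b = ∅ then (2 : ℝ) ^ m else 0 := by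
      refine Finset.prod_congr rfl fun b hb => ?_
      rw [← sum_character]
      simp [Finset.ne_of_mem_erase hb]
    rw [h2]
    simp only [if_true, sum_mul_character]
    split_ifs with h
    · rw [Finset.prod_congr rfl fun b hb => if_pos (h b (Finset.ne_of_mem_erase hb))]
      rw [mul_right_comm, Finset.mul_prod_erase Finset.univ (fun _ => (2 : ℝ) ^ m)
        (Finset.mem_univ β)]
      simp [← pow_mul, mul_comm m]
    · push Not at h
      obtain ⟨c, hc, hU⟩ := h
      rw [Finset.prod_eq_zero (Finset.mem_erase.mpr ⟨hc, Finset.mem_univ c⟩)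
        (if_neg hU.ne_empty)]
      simp
  have h : ∑ x, ADcomp τ m g x * character (glue A U) x = 2 ^ (2 ^ τ * m) *
      ∑ a, character A a * if ∀ c, c ≠ binIdx τ a → U c = ∅ then
        fourierCoeff g (U (binIdx τ a)) else 0 := by
    rw [← Equiv.sum_comp (splitEquiv τ m Bool), Fintype.sum_prod_type, Finset.mul_sum]
    refine Finset.sum_congr rfl fun a _ => ?_
    simp only [ADcomp_splitEquiv, character_glue, mul_left_comm _ (character A a)]
    rw [← Finset.mul_sum, key]
  rw [sum_mul_character, pow_add] at h
  rw [eq_div_iff (by positivity)]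
  refine mul_left_cancel₀ (b := _) (a := (2 : ℝ) ^ (2 ^ τ * m)) (by positivity) ?_
  rw [← h]
  ring

/-- The set with address part `A` whose only block part is `S`, in block `b`. -/
def blockSet {τ m : ℕ} (A : Finset (Fin τ)) (b : Fin (2 ^ τ)) (S : Finset (Fin m)) :
    Finset (Fin (τ + 2 ^ τ * m)) :=
  glue A fun c => if c = b then S else ∅

lemma blockSet_inj {τ m : ℕ} {A A' : Finset (Fin τ)} {b b' : Fin (2 ^ τ)}
    {S S' : Finset (Fin m)} (hS : S ≠ ∅) (h : blockSet A b S = blockSet A' b' S') :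
    A = A' ∧ b = b' ∧ S = S' := by
  obtain ⟨hA, hU⟩ := glue_inj.mp h
  have hb := congrFun hU b
  simp only [if_true] at hb
  split_ifs at hb with hbb
  · exact ⟨hA, hbb, hb⟩
  · exact absurd hb hS

lemma blockSet_ne_empty {τ m : ℕ} {A : Finset (Fin τ)} {b : Fin (2 ^ τ)}
    {S : Finset (Fin m)} (hS : S ≠ ∅) : blockSet A b S ≠ ∅ := by
  intro h
  rw [← glue_empty] at h
  have := congrFun (glue_inj.mp h).2 b
  simp [hS] at this

lemma fourierCoeff_ADcomp_empty {τ m : ℕ} (g : (Fin m → Bool) → ℝ) :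
    fourierCoeff (ADcomp τ m g) ∅ = fourierCoeff g ∅ := by
  rw [← glue_empty, fourierCoeff_ADcomp_glue]
  simp [character]

lemma abs_fourierCoeff_ADcomp_blockSet {τ m : ℕ} (g : (Fin m → Bool) → ℝ)
    (A : Finset (Fin τ)) (b : Fin (2 ^ τ)) {S : Finset (Fin m)} (hS : S ≠ ∅) :
    |fourierCoeff (ADcomp τ m g) (blockSet A b S)| = |fourierCoeff g S| / 2 ^ τ := by
  rw [blockSet, fourierCoeff_ADcomp_glue]
  obtain ⟨a, rfl⟩ := (binIdx_bijective τ).2 b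
  rw [Finset.sum_eq_single a]
  · rw [if_pos (fun c hc => if_neg hc)]
    simp [abs_div, abs_mul, abs_character]
  · intro a' _ ha
    have hne : binIdx τ a ≠ binIdx τ a' := fun h => ha ((binIdx_bijective τ).1 h).symm
    rw [if_neg, mul_zero]
    intro h
    exact hS (by simpa using h _ hne)
  · simp

lemma fourierCoeff_ADcomp_eq_zero {τ m : ℕ} (g : (Fin m → Bool) → ℝ)
    {T : Finset (Fin (τ + 2 ^ τ * m))} (hT : T ≠ ∅)
    (hb : ∀ A b S, S ≠ ∅ → T ≠ blockSet A b S) :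
    fourierCoeff (ADcomp τ m g) T = 0 := by
  obtain ⟨A, U, rfl⟩ := exists_eq_glue T
  rw [fourierCoeff_ADcomp_glue]
  by_cases hU : U = fun _ => ∅
  · subst hU
    have hA : A ≠ ∅ := fun h => hT (by rw [h, glue_empty])
    simp [← Finset.sum_mul, sum_character, hA]
  · obtain ⟨b, hbU⟩ := Function.ne_iff.mp hU
    rw [Finset.sum_eq_zero, zero_div]
    intro a _
    rw [if_neg, mul_zero]
    intro h
    have hba : b = binIdx τ a := by
      by_contra hne
      exact hbU (h b hne)
    refine hb A b (U b) hbU ?_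
    rw [blockSet]
    congr 1
    funext c
    split_ifs with hc
    · rw [hc]
    · exact h c (hba ▸ hc)

lemma weight_eq {n : ℕ} {f : (Fin n → Bool) → ℝ} (hf : IsBooleanFunc f) :
    weight f = (1 - fourierCoeff f ∅) / 2 := by
  have h : ∑ x, f x = 2 ^ n - 2 * ((Finset.univ.filter fun x => f x = -1).card : ℝ) := by
    have h1 (x) : f x = 1 - 2 * if f x = -1 then 1 else 0 := by
      rcases hf x with h | h <;> rw [h] <;> norm_num
    rw [Finset.sum_congr rfl fun x _ => h1 x, Finset.sum_sub_distrib, ← Finset.mul_sum,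
      Finset.sum_boole]
    simp
  simp only [weight, fourierCoeff, Finset.prod_empty, mul_one, h]
  field_simp
  ring

lemma indicatorVec_empty {n : ℕ} : indicatorVec (∅ : Finset (Fin n)) = 0 := by
  funext i
  simp [indicatorVec]

lemma exists_eq_indicatorVec {n : ℕ} (v : Fin n → ZMod 2) : ∃ S, v = indicatorVec S := by
  refine ⟨Finset.univ.filter fun i => v i = 1, ?_⟩
  funext i
  simp only [indicatorVec, Finset.mem_filter, Finset.mem_univ, true_and]
  generalize v i = z
  revert z
  decide

/-- `splitEquiv` for vectors, as a linear map. -/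
def splitLin (τ m : ℕ) :
    (Fin τ → ZMod 2) × (Fin (2 ^ τ) → Fin m → ZMod 2) →ₗ[ZMod 2]
      (Fin (τ + 2 ^ τ * m) → ZMod 2) where
  toFun := splitEquiv τ m (ZMod 2)
  map_add' p q := by
    funext i
    obtain ⟨j, rfl⟩ := (coordEquiv τ m).surjective i
    rcases j with j | j <;> simp [splitEquiv]
  map_smul' c p := by
    funext i
    obtain ⟨j, rfl⟩ := (coordEquiv τ m).surjective i
    rcases j with j | j <;> simp [splitEquiv]

lemma indicatorVec_blockSet {τ m : ℕ} (A : Finset (Fin τ)) (b : Fin (2 ^ τ))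
    (S : Finset (Fin m)) : indicatorVec (blockSet A b S) =
      splitLin τ m (indicatorVec A, Pi.single b (indicatorVec S)) := by
  funext i
  obtain ⟨j, rfl⟩ := (coordEquiv τ m).surjective i
  rcases j with j | ⟨c, l⟩
  · simp [indicatorVec, blockSet, splitLin, splitEquiv]
  · by_cases hc : c = b
    · subst hc
      simp [indicatorVec, blockSet, splitLin, splitEquiv]
    · simp [indicatorVec, blockSet, splitLin, splitEquiv, hc]

/-- Vectors whose block parts all lie in `W`. -/
def splitSubmodule (τ : ℕ) {m : ℕ} (W : Submodule (ZMod 2) (Fin m → ZMod 2)) :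
    (Fin τ → ZMod 2) × (Fin (2 ^ τ) → W) →ₗ[ZMod 2] (Fin (τ + 2 ^ τ * m) → ZMod 2) :=
  splitLin τ m ∘ₗ LinearMap.prodMap LinearMap.id
    (LinearMap.pi fun b => W.subtype ∘ₗ LinearMap.proj b)

lemma splitSubmodule_apply {τ m : ℕ} (W : Submodule (ZMod 2) (Fin m → ZMod 2))
    (p : (Fin τ → ZMod 2) × (Fin (2 ^ τ) → W)) :
    splitSubmodule τ W p = splitLin τ m (p.1, fun b => (p.2 b : Fin m → ZMod 2)) := rfl

lemma splitSubmodule_injective {τ m : ℕ} (W : Submodule (ZMod 2) (Fin m → ZMod 2)) :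
    Function.Injective (splitSubmodule τ W) := by
  intro p q h
  rw [splitSubmodule_apply, splitSubmodule_apply] at h
  have h' := (splitEquiv τ m (ZMod 2)).injective h
  simp only [Prod.mk.injEq] at h'
  refine Prod.ext h'.1 ?_
  funext b
  exact Subtype.ext (congrFun h'.2 b)

lemma finrank_span_of_blockSet {τ m : ℕ} {𝒯 : Set (Finset (Fin (τ + 2 ^ τ * m)))}
    {𝒮 : Set (Finset (Fin m))}
    (h : ∀ T, T ≠ ∅ → (T ∈ 𝒯 ↔ ∃ A b, ∃ S ∈ 𝒮, S ≠ ∅ ∧ T = blockSet A b S))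
    (hne : ∃ S ∈ 𝒮, S ≠ ∅) :
    Module.finrank (ZMod 2) ↥(Submodule.span (ZMod 2) (indicatorVec '' 𝒯)) =
      2 ^ τ * Module.finrank (ZMod 2) ↥(Submodule.span (ZMod 2) (indicatorVec '' 𝒮)) + τ := by
  set W := Submodule.span (ZMod 2) (indicatorVec '' 𝒮) with hW
  set V := Submodule.span (ZMod 2) (indicatorVec '' 𝒯) with hV
  have hblock : ∀ A b, ∀ S ∈ 𝒮, S ≠ ∅ →
      splitLin τ m (indicatorVec A, Pi.single b (indicatorVec S)) ∈ V := by
    intro A b S hS hS0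
    rw [← indicatorVec_blockSet]
    exact Submodule.subset_span ⟨_, (h _ (blockSet_ne_empty hS0)).mpr
      ⟨A, b, S, hS, hS0, rfl⟩, rfl⟩
  have haddr : ∀ v, splitLin τ m (v, 0) ∈ V := by
    intro v
    obtain ⟨A, rfl⟩ := exists_eq_indicatorVec v
    obtain ⟨S, hS, hS0⟩ := hne
    have hb : Fin (2 ^ τ) := ⟨0, by positivity⟩
    have := V.sub_mem (hblock A hb S hS hS0) (hblock ∅ hb S hS hS0)
    rw [← map_sub] at this
    simpa [indicatorVec_empty] using this
  have hsingle : ∀ b, W ≤ V.comap (splitLin τ m ∘ₗ LinearMap.inr _ _ _ ∘ₗ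
      LinearMap.single (ZMod 2) (fun _ => Fin m → ZMod 2) b) := by
    intro b
    rw [hW, Submodule.span_le]
    rintro _ ⟨S, hS, rfl⟩
    by_cases hS0 : S = ∅
    · rw [hS0, indicatorVec_empty]
      exact Submodule.zero_mem _
    · have := hblock ∅ b S hS hS0
      rw [indicatorVec_empty] at this
      simpa using this
  have hrange : LinearMap.range (splitSubmodule τ W) = V := by
    apply le_antisymm
    · rintro _ ⟨⟨v, w⟩, rfl⟩
      have hw : splitSubmodule τ W (v, w) = splitLin τ m (v, 0) +
          ∑ b, splitLin τ m (0, Pi.single b (w b : Fin m → ZMod 2)) := by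
        rw [splitSubmodule_apply, ← map_sum, ← map_add]
        congr 1
        refine Prod.ext ?_ ?_
        · simp [Prod.fst_sum]
        · simp only [Prod.snd_add, Prod.snd_sum, zero_add]
          exact (Finset.univ_sum_single fun b => (w b : Fin m → ZMod 2)).symm
      rw [hw]
      exact V.add_mem (haddr v) (V.sum_mem fun b _ => hsingle b (w b).2)
    · rw [hV, Submodule.span_le]
      rintro _ ⟨T, hT, rfl⟩
      by_cases hT0 : T = ∅
      · rw [hT0, indicatorVec_empty]
        exact Submodule.zero_mem _
      obtain ⟨A, b, S, hS, -, rfl⟩ := (h T hT0).mp hT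
      refine ⟨(indicatorVec A,
        Pi.single b ⟨indicatorVec S, Submodule.subset_span ⟨S, hS, rfl⟩⟩), ?_⟩
      rw [splitSubmodule_apply, indicatorVec_blockSet]
      congr 2
      funext c
      by_cases hc : c = b
      · subst hc
        simp
      · simp [hc]
  rw [← hrange, LinearMap.finrank_range_of_inj (splitSubmodule_injective W)]
  simp [Module.finrank_prod, Module.finrank_pi_fintype, add_comm]

lemma span_indicatorVec_eq_bot {n : ℕ} {𝒯 : Set (Finset (Fin n))} (h : ∀ T ∈ 𝒯, T = ∅) :
    Submodule.span (ZMod 2) (indicatorVec '' 𝒯) = ⊥ := by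
  rw [Submodule.span_eq_bot]
  rintro _ ⟨T, hT, rfl⟩
  rw [h T hT, indicatorVec_empty]

lemma finrank_span_indicatorVec_pos {n : ℕ} {𝒯 : Set (Finset (Fin n))}
    (h : ∃ T ∈ 𝒯, T ≠ ∅) :
    0 < Module.finrank (ZMod 2) ↥(Submodule.span (ZMod 2) (indicatorVec '' 𝒯)) := by
  rw [Nat.pos_iff_ne_zero, Ne, Submodule.finrank_eq_zero, Submodule.span_eq_bot]
  obtain ⟨T, hT, hT0⟩ := h
  obtain ⟨i, hi⟩ := Finset.nonempty_iff_ne_empty.mpr hT0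
  intro h0
  have := congrFun (h0 _ ⟨T, hT, rfl⟩) i
  simp [indicatorVec, hi] at this

lemma exists_blockSet_of_fourierCoeff_ne_zero {τ m : ℕ} {g : (Fin m → Bool) → ℝ}
    {T : Finset (Fin (τ + 2 ^ τ * m))} (hT0 : T ≠ ∅)
    (hT : fourierCoeff (ADcomp τ m g) T ≠ 0) : ∃ A b S, S ≠ ∅ ∧ T = blockSet A b S := by
  by_contra! hcon
  exact hT (fourierCoeff_ADcomp_eq_zero g hT0 fun A b S hS =>
    hcon A b S (Finset.nonempty_iff_ne_empty.mpr hS))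

lemma fourierCoeff_ADcomp_blockSet_ne_zero {τ m : ℕ} {g : (Fin m → Bool) → ℝ}
    {A : Finset (Fin τ)} {b : Fin (2 ^ τ)} {S : Finset (Fin m)} (hS : S ≠ ∅) :
    fourierCoeff (ADcomp τ m g) (blockSet A b S) ≠ 0 ↔ fourierCoeff g S ≠ 0 := by
  rw [← abs_ne_zero, abs_fourierCoeff_ADcomp_blockSet g A b hS]
  simp

lemma mem_fourierSupport {n : ℕ} {f : (Fin n → Bool) → ℝ} {S : Finset (Fin n)} :
    S ∈ fourierSupport f ↔ fourierCoeff f S ≠ 0 := by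
  simp [fourierSupport]

lemma mem_fourierSupport_ADcomp {τ m : ℕ} {g : (Fin m → Bool) → ℝ}
    {T : Finset (Fin (τ + 2 ^ τ * m))} (hT0 : T ≠ ∅) :
    T ∈ fourierSupport (ADcomp τ m g) ↔
      ∃ A b, ∃ S ∈ fourierSupport g, S ≠ ∅ ∧ T = blockSet A b S := by
  simp only [mem_fourierSupport]
  constructor
  · intro hT
    obtain ⟨A, b, S, hS, rfl⟩ := exists_blockSet_of_fourierCoeff_ne_zero hT0 hT
    exact ⟨A, b, S, (fourierCoeff_ADcomp_blockSet_ne_zero hS).mp hT, hS, rfl⟩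
  · rintro ⟨A, b, S, hg, hS, rfl⟩
    exact (fourierCoeff_ADcomp_blockSet_ne_zero hS).mpr hg

lemma fourierRank_ADcomp {τ m : ℕ} {g : (Fin m → Bool) → ℝ}
    (h : ∃ S ∈ fourierSupport g, S ≠ ∅) :
    fourierRank (ADcomp τ m g) = 2 ^ τ * fourierRank g + τ :=
  finrank_span_of_blockSet (fun _ hT0 => mem_fourierSupport_ADcomp hT0) h

lemma level_mul_iff {τ : ℕ} (s c : ℝ) :
    1 / ((2 : ℝ) ^ τ * s) ≤ c / 2 ^ τ ↔ 1 / s ≤ c := by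
  rw [mul_comm, ← div_div, div_le_div_iff_of_pos_right (by positivity)]

lemma levelDim_ADcomp {τ m : ℕ} {g : (Fin m → Bool) → ℝ} {s : ℝ} (hs : 0 < s)
    (h : ∃ S, 1 / s ≤ |fourierCoeff g S| ∧ S ≠ ∅) :
    levelDim (ADcomp τ m g) (2 ^ τ * s) = 2 ^ τ * levelDim g s + τ := by
  refine finrank_span_of_blockSet (fun T hT0 => ?_) h
  simp only [Set.mem_ofPred_eq]
  constructor
  · intro hT
    have hpos : 0 < 1 / ((2 : ℝ) ^ τ * s) := by positivity
    obtain ⟨A, b, S, hS, rfl⟩ := exists_blockSet_of_fourierCoeff_ne_zero hT0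
      (abs_pos.mp (hpos.trans_le hT))
    rw [abs_fourierCoeff_ADcomp_blockSet g A b hS, level_mul_iff] at hT
    exact ⟨A, b, S, hT, hS, rfl⟩
  · rintro ⟨A, b, S, hg, hS, rfl⟩
    rwa [abs_fourierCoeff_ADcomp_blockSet g A b hS, level_mul_iff]

lemma levelDim_ADcomp_eq_fourierRank_iff {τ m : ℕ} {g : (Fin m → Bool) → ℝ}
    (hg : ∃ S ∈ fourierSupport g, S ≠ ∅) {s : ℝ} (hs : 0 < s) :
    levelDim (ADcomp τ m g) (2 ^ τ * s) = fourierRank (ADcomp τ m g) ↔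
      levelDim g s = fourierRank g := by
  by_cases h : ∃ S, 1 / s ≤ |fourierCoeff g S| ∧ S ≠ ∅
  · rw [levelDim_ADcomp hs h, fourierRank_ADcomp hg]
    simp
  · push Not at h
    have h1 : levelDim g s = 0 := by
      rw [levelDim, span_indicatorVec_eq_bot, finrank_bot]
      exact fun S hS => h S hS
    have h2 : levelDim (ADcomp τ m g) (2 ^ τ * s) = 0 := by
      rw [levelDim, span_indicatorVec_eq_bot, finrank_bot]
      intro T hT
      by_contra hT0
      have hpos : 0 < 1 / ((2 : ℝ) ^ τ * s) := by positivity
      obtain ⟨A, b, S, hS, rfl⟩ := exists_blockSet_of_fourierCoeff_ne_zero hT0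
        (abs_pos.mp (hpos.trans_le hT))
      rw [Set.mem_ofPred_eq, abs_fourierCoeff_ADcomp_blockSet g A b hS, level_mul_iff] at hT
      exact hS (h S hT)
    have h3 : 0 < fourierRank g := finrank_span_indicatorVec_pos hg
    have h4 : 0 < fourierRank (ADcomp τ m g) := by
      rw [fourierRank_ADcomp hg]
      positivity
    omega

open scoped Pointwise in
lemma maxRankEntropy_ADcomp {τ m : ℕ} {g : (Fin m → Bool) → ℝ}
    (hg : ∃ S ∈ fourierSupport g, S ≠ ∅) :
    maxRankEntropy (ADcomp τ m g) = (2 ^ τ : ℝ) * maxRankEntropy g := by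
  have hset : {t : ℝ | 0 < t ∧ levelDim (ADcomp τ m g) t = fourierRank (ADcomp τ m g)} =
      (2 ^ τ : ℝ) • {t : ℝ | 0 < t ∧ levelDim g t = fourierRank g} := by
    ext t
    rw [Set.mem_smul_set]
    simp only [Set.mem_ofPred_eq, smul_eq_mul]
    constructor
    · rintro ⟨ht, h⟩
      have ht' : (2 : ℝ) ^ τ * (t / 2 ^ τ) = t := by field_simp
      refine ⟨t / 2 ^ τ, ⟨by positivity, ?_⟩, ht'⟩
      rwa [← levelDim_ADcomp_eq_fourierRank_iff (τ := τ) hg (by positivity), ht']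
    · rintro ⟨s, ⟨hs, h⟩, rfl⟩
      exact ⟨by positivity, (levelDim_ADcomp_eq_fourierRank_iff hg hs).mpr h⟩
  rw [maxRankEntropy, hset, Real.sInf_smul_of_nonneg (by positivity), smul_eq_mul,
    maxRankEntropy]

lemma sparsity_ADcomp {τ m : ℕ} {g : (Fin m → Bool) → ℝ} (h0 : fourierCoeff g ∅ ≠ 0) :
    sparsity (ADcomp τ m g) = 1 + (2 ^ τ) ^ 2 * (sparsity g - 1) := by
  have hsupp : (fourierSupport (ADcomp τ m g)).erase ∅ =
      ((Finset.univ : Finset (Finset (Fin τ))) ×ˢ (Finset.univ : Finset (Fin (2 ^ τ))) ×ˢ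
        (fourierSupport g).erase ∅).image fun p => blockSet p.1 p.2.1 p.2.2 := by
    ext T
    simp only [Finset.mem_erase, Finset.mem_image, Finset.mem_product, Finset.mem_univ,
      true_and, Prod.exists]
    constructor
    · rintro ⟨hT0, hT⟩
      obtain ⟨A, b, S, hg, hS, rfl⟩ := (mem_fourierSupport_ADcomp hT0).mp hT
      exact ⟨A, b, S, ⟨hS, hg⟩, rfl⟩
    · rintro ⟨A, b, S, ⟨hS, hg⟩, rfl⟩
      have hne := blockSet_ne_empty (A := A) (b := b) hS
      exact ⟨hne, (mem_fourierSupport_ADcomp hne).mpr ⟨A, b, S, hg, hS, rfl⟩⟩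
  have hmem : ∅ ∈ fourierSupport (ADcomp τ m g) := by
    rwa [mem_fourierSupport, fourierCoeff_ADcomp_empty]
  rw [sparsity, ← Finset.card_erase_add_one hmem, hsupp, Finset.card_image_of_injOn,
    Finset.card_product, Finset.card_product,
    Finset.card_erase_of_mem (mem_fourierSupport.mpr h0), sparsity]
  · simp only [Finset.card_univ, Fintype.card_finset, Fintype.card_fin]
    ring
  · rintro ⟨A, b, S⟩ hp ⟨A', b', S'⟩ - h
    simp only [Finset.coe_product, Set.mem_prod, Finset.mem_coe, Finset.mem_erase] at hp
    obtain ⟨rfl, rfl, rfl⟩ := blockSet_inj hp.2.2.1 h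
    rfl

lemma bddAbove_entropies {n : ℕ} (f : (Fin n → Bool) → ℝ) :
    BddAbove ((fun S => 1 / |fourierCoeff f S|) '' (fourierSupport f : Set (Finset (Fin n)))) :=
  ((fourierSupport f).finite_toSet.image _).bddAbove

lemma maxSuppEntropy_ADcomp {τ m : ℕ} {g : (Fin m → Bool) → ℝ}
    (hS : ∃ S : Finset (Fin m), S ≠ ∅ ∧ fourierCoeff g S ≠ 0 ∧
      |fourierCoeff g S| ≤ |fourierCoeff g ∅|) :
    maxSuppEntropy (ADcomp τ m g) = (2 ^ τ : ℝ) * maxSuppEntropy g := by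
  obtain ⟨S, hS0, hgS, hle⟩ := hS
  have hentry (A : Finset (Fin τ)) (b) {S : Finset (Fin m)} (hS0 : S ≠ ∅) :
      1 / |fourierCoeff (ADcomp τ m g) (blockSet A b S)| =
        2 ^ τ * (1 / |fourierCoeff g S|) := by
    rw [abs_fourierCoeff_ADcomp_blockSet g A b hS0, one_div_div, mul_one_div]
  have hub {S : Finset (Fin m)} (hgS : fourierCoeff g S ≠ 0) :
      1 / |fourierCoeff g S| ≤ maxSuppEntropy g :=
    le_csSup (bddAbove_entropies g) ⟨S, mem_fourierSupport.mpr hgS, rfl⟩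
  have hub' {S : Finset (Fin m)} (hS0 : S ≠ ∅) (hgS : fourierCoeff g S ≠ 0) :
      2 ^ τ * (1 / |fourierCoeff g S|) ≤ maxSuppEntropy (ADcomp τ m g) := by
    rw [← hentry ∅ ⟨0, by positivity⟩ hS0]
    exact le_csSup (bddAbove_entropies _)
      ⟨_, mem_fourierSupport.mpr ((fourierCoeff_ADcomp_blockSet_ne_zero hS0).mpr hgS), rfl⟩
  have hempty : 1 / |fourierCoeff g ∅| ≤ 1 / |fourierCoeff g S| :=
    one_div_le_one_div_of_le (abs_pos.mpr hgS) hle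
  apply le_antisymm
  · refine Real.sSup_le ?_ ?_
    · rintro _ ⟨T, hT, rfl⟩
      by_cases hT0 : T = ∅
      · subst hT0
        simp only [fourierCoeff_ADcomp_empty]
        refine (hempty.trans (hub hgS)).trans (le_mul_of_one_le_left ?_ ?_)
        · exact le_trans (by positivity) (hub hgS)
        · exact one_le_pow₀ one_le_two
      · obtain ⟨A, b, S', hg', hS', rfl⟩ := (mem_fourierSupport_ADcomp hT0).mp hT
        simp only [hentry A b hS']
        exact mul_le_mul_of_nonneg_left (hub (mem_fourierSupport.mp hg')) (by positivity)
    · exact mul_nonneg (by positivity) (le_trans (by positivity) (hub hgS))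
  · rw [← le_div_iff₀' (by positivity)]
    refine csSup_le ⟨_, S, mem_fourierSupport.mpr hgS, rfl⟩ ?_
    rintro _ ⟨S', hS', rfl⟩
    simp only
    rw [le_div_iff₀' (by positivity)]
    by_cases hS'0 : S' = ∅
    · subst hS'0
      exact (mul_le_mul_of_nonneg_left hempty (by positivity)).trans (hub' hS0 hgS)
    · exact hub' hS'0 (mem_fourierSupport.mp hS')

lemma weight_ADcomp {τ m : ℕ} {g : (Fin m → Bool) → ℝ} (hg : IsBooleanFunc g) :
    weight (ADcomp τ m g) = weight g := by
  rw [weight_eq hg, weight_eq (f := ADcomp τ m g) (fun _ => hg _), fourierCoeff_ADcomp_empty]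

/-- **Composition lemma.** For `t = 2^τ ≥ 2`, `m ≥ 1`, and a non-constant Boolean `g`
possessing a non-empty `S` with `0 ≠ |ĝ(S)| ≤ |ĝ(∅)|`, the function `f = AD_t ∘ₜ g`
satisfies `r(f) = t·r(g) + log t`, `k(f) = 1 + t²(k(g) - 1)`, `k'(f) = t·k'(g)`,
`k''(f) = t·k''(g)` and `δ(f) = δ(g)`. -/
theorem ADcomp_measures
    (τ m : ℕ) (hτ : 1 ≤ τ) (hm : 1 ≤ m)
    (g : (Fin m → Bool) → ℝ) (hg : IsBooleanFunc g)
    (hgnc : ∃ x y, g x ≠ g y)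
    (hS : ∃ S : Finset (Fin m), S ≠ ∅ ∧ fourierCoeff g S ≠ 0 ∧
      |fourierCoeff g S| ≤ |fourierCoeff g ∅|) :
    fourierRank (ADcomp τ m g) = 2 ^ τ * fourierRank g + τ ∧
    sparsity (ADcomp τ m g) = 1 + (2 ^ τ) ^ 2 * (sparsity g - 1) ∧
    maxSuppEntropy (ADcomp τ m g) = (2 ^ τ : ℝ) * maxSuppEntropy g ∧
    maxRankEntropy (ADcomp τ m g) = (2 ^ τ : ℝ) * maxRankEntropy g ∧
    weight (ADcomp τ m g) = weight g := by
  obtain ⟨S, hS0, hgS, hle⟩ := hS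
  have hne : ∃ S ∈ fourierSupport g, S ≠ ∅ := ⟨S, mem_fourierSupport.mpr hgS, hS0⟩
  have h0 : fourierCoeff g ∅ ≠ 0 := abs_pos.mp ((abs_pos.mpr hgS).trans_le hle)
  exact ⟨fourierRank_ADcomp hne, sparsity_ADcomp h0,
    maxSuppEntropy_ADcomp ⟨S, hS0, hgS, hle⟩, maxRankEntropy_ADcomp hne, weight_ADcomp hg⟩

end BoolFunc

end
end

section
/- Let t ≥ 2, t' ≥ 2 and a ≥ 2t' be powers of 2, and let AD_{t,t',a} = AD_t ∘ₜ (AND_{log a}, AND_{log t'}, …, AND_{log t'}) : {-1,1}^{log t} × {-1,1}^{log a} × {-1,1}^{(t−1)·log t'} → {-1,1} (the first target variable of AD_t is replaced by AND_{log a} and each of the remaining t−1 target variables by AND_{log t'}, all on fresh disjoint blocks of variables). Then: r(AD_{t,t',a}) = (t−1)·log t' + log a + log t; k(AD_{t,t',a}) = (t−1)(t'−1)t + t·a; k'(AD_{t,t',a}) = k''(AD_{t,t',a}) = t·a/2; and δ(AD_{t,t',a}) = 1/t' + 1/(a·t) − 1/(t·t'). -/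
open scoped BigOperators
open scoped Classical

noncomputable section

namespace BoolFunc

/-- `AD_{t,t',a} = AD_t ∘ₜ (AND_{log a}, AND_{log t'}, …, AND_{log t'})` with `t = 2^τ`,
`a = 2^α`, `t' = 2^σ`: the target at address `1^{log t}` (index `0` here, since `1` is
read as bit `0`) is an `AND` on `α` fresh variables, the other `t - 1` targets are `AND`s
on `σ` fresh variables each. -/
def ADtta (τ α σ : ℕ) : (Fin (τ + (α + (2 ^ τ - 1) * σ)) → Bool) → ℝ :=
  fun x =>
    let j : Fin (2 ^ τ) := binIdx τ (fun i => x (Fin.castAdd (α + (2 ^ τ - 1) * σ) i))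
    if hj : (j : ℕ) = 0 then
      (if ∀ l : Fin α, x (Fin.natAdd τ (Fin.castAdd ((2 ^ τ - 1) * σ) l)) = true
        then -1 else 1)
    else
      (if ∀ l : Fin σ,
          x (Fin.natAdd τ (Fin.natAdd α (finProdFinEquiv
            (⟨(j : ℕ) - 1, by have := j.isLt; omega⟩, l)))) = true
        then -1 else 1)

section Measures

open Finset

lemma sum_prod_signv {n : ℕ} (S : Finset (Fin n)) :
    ∑ x : Fin n → Bool, ∏ i ∈ S, signv (x i) = if S = ∅ then 2 ^ n else 0 := by
  have h1 : ∀ x : Fin n → Bool,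
      ∏ i ∈ S, signv (x i) = ∏ i, if i ∈ S then signv (x i) else 1 := by
    intro x; simp [Finset.prod_ite_mem]
  have h2 : ∑ x : Fin n → Bool, ∏ i, (if i ∈ S then signv (x i) else 1) =
      ∏ i, ∑ b : Bool, (if i ∈ S then signv b else 1) := by
    rw [Finset.prod_univ_sum, Fintype.piFinset_univ]
  simp_rw [h1]
  rw [h2]
  split_ifs with h
  · subst h; simp
  · obtain ⟨i, hi⟩ := Finset.nonempty_iff_ne_empty.mpr h
    exact Finset.prod_eq_zero (Finset.mem_univ i) (by simp [hi, signv])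

/-- Fourier coefficients of the indicator of the subcube fixing the coordinates in `P` to `w`. -/
lemma fourierCoeff_subcube {n : ℕ} (P : Finset (Fin n)) (w : Fin n → Bool) (S : Finset (Fin n)) :
    fourierCoeff (fun x => if ∀ i ∈ P, x i = w i then 1 else 0) S =
      if S ⊆ P then (∏ i ∈ S, signv (w i)) / 2 ^ P.card else 0 := by
  have h1 : ∀ x : Fin n → Bool,
      (if ∀ i ∈ P, x i = w i then (1 : ℝ) else 0) * ∏ i ∈ S, signv (x i) =
      ∏ i, (if i ∈ P → x i = w i then 1 else 0) * (if i ∈ S then signv (x i) else 1) := by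
    intro x
    rw [Finset.prod_mul_distrib]
    congr 1
    · rw [Finset.prod_ite_zero]; simp
    · simp [Finset.prod_ite_mem]
  have h2 : ∑ x : Fin n → Bool, ∏ i,
      (if i ∈ P → x i = w i then (1 : ℝ) else 0) * (if i ∈ S then signv (x i) else 1) =
      ∏ i, ∑ b : Bool,
        (if i ∈ P → b = w i then (1 : ℝ) else 0) * (if i ∈ S then signv b else 1) := by
    rw [Finset.prod_univ_sum, Fintype.piFinset_univ]
  have h3 : ∀ i, (∑ b : Bool,
        (if i ∈ P → b = w i then (1 : ℝ) else 0) * (if i ∈ S then signv b else 1)) =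
      (if i ∈ P then (if i ∈ S then signv (w i) else 1) else (if i ∈ S then 0 else 2)) := by
    intro i
    by_cases hP : i ∈ P <;> by_cases hS : i ∈ S <;> cases hw : w i <;>
      simp [hP, hS, signv]
  unfold fourierCoeff
  simp_rw [h1]
  rw [h2]
  simp_rw [h3]
  split_ifs with h
  · have h4 : ∀ i, (if i ∈ P then (if i ∈ S then signv (w i) else 1)
        else (if i ∈ S then 0 else 2)) =
        (if i ∈ S then signv (w i) else 1) * (2 / (if i ∈ P then 2 else 1)) := by
      intro i
      by_cases hP : i ∈ P
      · simp [hP]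
      · have : i ∉ S := fun hS => hP (h hS)
        simp [hP, this]
    simp_rw [h4]
    rw [Finset.prod_mul_distrib, Finset.prod_div_distrib]
    simp [Finset.prod_ite_mem]
    field_simp
  · obtain ⟨i, hS, hP⟩ := Finset.not_subset.mp h
    rw [Finset.prod_eq_zero (Finset.mem_univ i) (by simp [hS, hP]), zero_div]

lemma binIdx_injective (τ : ℕ) : Function.Injective (binIdx τ) := by
  intro u v h
  have h' := finFunctionFinEquiv.injective h
  funext i
  have := congrFun h' i
  cases hu : u i <;> cases hv : v i <;> simp_all

lemma binIdx_surjective (τ : ℕ) : Function.Surjective (binIdx τ) :=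
  ((Fintype.bijective_iff_injective_and_card _).2 ⟨binIdx_injective τ, by simp⟩).2

lemma binIdx_val_eq_zero (τ : ℕ) (v : Fin τ → Bool) :
    (binIdx τ v : ℕ) = 0 ↔ v = fun _ => false := by
  have h0 : (binIdx τ (fun _ => false) : ℕ) = 0 := by
    simp [binIdx, finFunctionFinEquiv]
  constructor
  · intro h
    exact binIdx_injective τ (Fin.ext (h.trans h0.symm))
  · rintro rfl
    exact h0

variable (τ α σ : ℕ)

/-- The address coordinates of `ADtta τ α σ`. -/
def addrBlock : Finset (Fin (τ + (α + (2 ^ τ - 1) * σ))) :=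
  univ.map (Fin.castAddEmb (α + (2 ^ τ - 1) * σ))

/-- The coordinates of the target addressed by `v`. -/
def targetBlock (v : Fin τ → Bool) : Finset (Fin (τ + (α + (2 ^ τ - 1) * σ))) :=
  if hj : (binIdx τ v : ℕ) = 0 then
    univ.image fun l : Fin α => Fin.natAdd τ (Fin.castAdd ((2 ^ τ - 1) * σ) l)
  else
    univ.image fun l : Fin σ => Fin.natAdd τ (Fin.natAdd α (finProdFinEquiv
      (⟨(binIdx τ v : ℕ) - 1, by have := (binIdx τ v).isLt; omega⟩, l)))

/-- The coordinates that `ADtta τ α σ` reads when the address is `v`. -/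
def readBlock (v : Fin τ → Bool) : Finset (Fin (τ + (α + (2 ^ τ - 1) * σ))) :=
  addrBlock τ α σ ∪ targetBlock τ α σ v

/-- The point with address `v` and all targets' inputs equal to `-1`. -/
def addrPoint (v : Fin τ → Bool) : Fin (τ + (α + (2 ^ τ - 1) * σ)) → Bool :=
  Fin.append v fun _ => true

variable {τ α σ}

lemma mem_addrBlock {i : Fin (τ + (α + (2 ^ τ - 1) * σ))} :
    i ∈ addrBlock τ α σ ↔ (i : ℕ) < τ := by
  simp only [addrBlock, mem_map, mem_univ, true_and, Fin.castAddEmb_apply]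
  constructor
  · rintro ⟨l, rfl⟩
    simp
  · intro h
    exact ⟨⟨i, h⟩, rfl⟩

lemma le_of_mem_targetBlock {v : Fin τ → Bool} {i : Fin (τ + (α + (2 ^ τ - 1) * σ))}
    (h : i ∈ targetBlock τ α σ v) : τ ≤ i := by
  unfold targetBlock at h
  split_ifs at h <;> simp only [mem_image, mem_univ, true_and] at h <;>
    obtain ⟨l, rfl⟩ := h <;> simp

lemma disjoint_addrBlock_targetBlock (v : Fin τ → Bool) :
    Disjoint (addrBlock τ α σ) (targetBlock τ α σ v) := by
  rw [Finset.disjoint_left]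
  intro i h1 h2
  have := mem_addrBlock.1 h1
  have := le_of_mem_targetBlock h2
  omega

lemma eq_of_mem_targetBlock {u v : Fin τ → Bool} {i : Fin (τ + (α + (2 ^ τ - 1) * σ))}
    (hu : i ∈ targetBlock τ α σ u) (hv : i ∈ targetBlock τ α σ v) : u = v := by
  apply binIdx_injective
  apply Fin.ext
  unfold targetBlock at hu hv
  split_ifs at hu hv with h1 h2 h2
  · omega
  · simp only [mem_image, mem_univ, true_and] at hu hv
    obtain ⟨l, rfl⟩ := hu
    obtain ⟨k, hk⟩ := hv
    have := congrArg Fin.val hk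
    simp at this
    omega
  · simp only [mem_image, mem_univ, true_and] at hu hv
    obtain ⟨l, rfl⟩ := hu
    obtain ⟨k, hk⟩ := hv
    have := congrArg Fin.val hk
    simp at this
    omega
  · simp only [mem_image, mem_univ, true_and] at hu hv
    obtain ⟨l, rfl⟩ := hu
    obtain ⟨k, hk⟩ := hv
    have := finProdFinEquiv.injective (Fin.natAdd_injective _ _ (Fin.natAdd_injective _ _ hk))
    simp only [Prod.mk.injEq, Fin.mk.injEq] at this
    omega

lemma exists_mem_targetBlock {i : Fin (τ + (α + (2 ^ τ - 1) * σ))}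
    (hi : i ∉ addrBlock τ α σ) : ∃ v, i ∈ targetBlock τ α σ v := by
  induction i using Fin.addCases with
  | left i => exact absurd (mem_addrBlock.2 (by simp)) hi
  | right i =>
    induction i using Fin.addCases with
    | left l =>
      refine ⟨fun _ => false, ?_⟩
      rw [targetBlock, dif_pos ((binIdx_val_eq_zero τ _).2 rfl)]
      simp
    | right l =>
      obtain ⟨⟨j, l⟩, rfl⟩ := finProdFinEquiv.surjective l
      have hj := j.isLt
      obtain ⟨v, hv⟩ := binIdx_surjective τ ⟨j + 1, by omega⟩
      have hv' : (binIdx τ v : ℕ) = j + 1 := by rw [hv]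
      refine ⟨v, ?_⟩
      rw [targetBlock, dif_neg (by omega)]
      simp [hv']

lemma card_targetBlock (v : Fin τ → Bool) :
    (targetBlock τ α σ v).card = if v = fun _ => false then α else σ := by
  unfold targetBlock
  simp only [binIdx_val_eq_zero]
  split_ifs with h
  · rw [Finset.card_image_of_injective, Finset.card_univ, Fintype.card_fin]
    intro a b hab
    simpa [Fin.ext_iff] using hab
  · rw [Finset.card_image_of_injective, Finset.card_univ, Fintype.card_fin]
    intro a b hab
    have := finProdFinEquiv.injective (Fin.natAdd_injective _ _ (Fin.natAdd_injective _ _ hab))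
    simpa using this

lemma card_addrBlock : (addrBlock τ α σ).card = τ := by
  simp [addrBlock]

lemma card_readBlock (v : Fin τ → Bool) :
    (readBlock τ α σ v).card = τ + if v = fun _ => false then α else σ := by
  rw [readBlock, Finset.card_union_of_disjoint (disjoint_addrBlock_targetBlock v),
    card_addrBlock, card_targetBlock]

lemma ADtta_eq_sum (x : Fin (τ + (α + (2 ^ τ - 1) * σ)) → Bool) :
    ADtta τ α σ x = 1 - 2 * ∑ v : Fin τ → Bool,
      if ∀ i ∈ readBlock τ α σ v, x i = addrPoint τ α σ v i then 1 else 0 := by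
  have key : ∀ v : Fin τ → Bool, (∀ i ∈ readBlock τ α σ v, x i = addrPoint τ α σ v i) ↔
      v = (fun i => x (Fin.castAdd _ i)) ∧ ∀ i ∈ targetBlock τ α σ v, x i = true := by
    intro v
    simp only [readBlock, mem_union, or_imp, forall_and]
    refine and_congr ?_ ?_
    · simp only [addrBlock, mem_map, mem_univ, true_and, forall_exists_index,
        forall_apply_eq_imp_iff, Fin.castAddEmb_apply, addrPoint, Fin.append_left, funext_iff]
      exact forall_congr' fun i => eq_comm
    · refine forall₂_congr fun i hi => ?_
      have h := le_of_mem_targetBlock hi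
      induction i using Fin.addCases with
      | left i => simp at h; omega
      | right i => simp [addrPoint]
  simp_rw [key]
  rw [Finset.sum_eq_single (fun i => x (Fin.castAdd _ i))
    (fun v _ hv => if_neg fun h => hv h.1) (fun h => absurd (mem_univ _) h)]
  simp only [true_and, ADtta, targetBlock]
  split_ifs <;> simp_all <;> norm_num

lemma fourierCoeff_ADtta (S : Finset (Fin (τ + (α + (2 ^ τ - 1) * σ)))) :
    fourierCoeff (ADtta τ α σ) S = (if S = ∅ then 1 else 0) - 2 * ∑ v : Fin τ → Bool,
      if S ⊆ readBlock τ α σ v then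
        (∏ i ∈ S, signv (addrPoint τ α σ v i)) / 2 ^ (readBlock τ α σ v).card else 0 := by
  simp_rw [← fourierCoeff_subcube]
  unfold fourierCoeff
  simp_rw [ADtta_eq_sum, sub_mul, one_mul]
  rw [Finset.sum_sub_distrib, sum_prod_signv, sub_div]
  congr 1
  · split_ifs <;> simp
  · rw [← Finset.sum_div, Finset.sum_comm, ← mul_div_assoc, Finset.mul_sum]
    congr 1
    refine Finset.sum_congr rfl fun x _ => ?_
    rw [← Finset.sum_mul, mul_assoc]

lemma fourierCoeff_ADtta_addr {S : Finset (Fin (τ + (α + (2 ^ τ - 1) * σ)))}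
    (hS : S ⊆ addrBlock τ α σ) :
    fourierCoeff (ADtta τ α σ) S = (if S = ∅ then 1 - 2 / 2 ^ σ else 0) +
      2 / 2 ^ τ * (1 / 2 ^ σ - 1 / 2 ^ α) := by
  have hsub : ∀ v, S ⊆ readBlock τ α σ v := fun v => hS.trans subset_union_left
  obtain ⟨A, -, rfl⟩ := Finset.subset_map_iff.1 hS
  rw [fourierCoeff_ADtta]
  have h1 : ∀ v : Fin τ → Bool, (if A.map (Fin.castAddEmb _) ⊆ readBlock τ α σ v then
        (∏ i ∈ A.map (Fin.castAddEmb _), signv (addrPoint τ α σ v i)) /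
          2 ^ (readBlock τ α σ v).card else 0) =
      (∏ i ∈ A, signv (v i)) * (1 / 2 ^ τ / 2 ^ σ) +
        (if v = fun _ => false then 1 / 2 ^ τ * (1 / 2 ^ α - 1 / 2 ^ σ) else 0) := by
    intro v
    rw [if_pos (hsub v), card_readBlock, Finset.prod_map]
    simp only [Fin.castAddEmb_apply, addrPoint, Fin.append_left]
    split_ifs with h
    · subst h
      simp only [signv, Bool.false_eq_true, if_false, prod_const_one, pow_add]
      field_simp
      ring
    · rw [pow_add]
      field_simp
      ring
  simp_rw [h1]
  rw [Finset.sum_add_distrib, ← Finset.sum_mul, sum_prod_signv, Finset.sum_ite_eq']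
  simp only [Finset.map_eq_empty, mem_univ, if_true]
  split_ifs <;> field_simp <;> ring

lemma abs_fourierCoeff_ADtta_target {S : Finset (Fin (τ + (α + (2 ^ τ - 1) * σ)))}
    (hS : ¬ S ⊆ addrBlock τ α σ) {v : Fin τ → Bool} (hv : S ⊆ readBlock τ α σ v) :
    |fourierCoeff (ADtta τ α σ) S| = 2 / (2 ^ τ * 2 ^ (if v = fun _ => false then α else σ)) := by
  have hne : S ≠ ∅ := by rintro rfl; simp at hS
  rw [fourierCoeff_ADtta, if_neg hne, Finset.sum_eq_single v, if_pos hv, card_readBlock, zero_sub,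
    abs_neg, abs_mul, abs_div, Finset.abs_prod]
  · have : ∀ b, |signv b| = 1 := by intro b; cases b <;> simp [signv]
    simp only [this, prod_const_one, abs_two, abs_pow, pow_add, abs_mul, mul_one_div]
  · intro u _ huv
    refine if_neg fun hu => huv ?_
    obtain ⟨i, hi, hi'⟩ := Finset.not_subset.1 hS
    have h1 := hu hi
    have h2 := hv hi
    simp only [readBlock, mem_union, hi', false_or] at h1 h2
    exact eq_of_mem_targetBlock h1 h2
  · simp

lemma fourierCoeff_ADtta_eq_zero {S : Finset (Fin (τ + (α + (2 ^ τ - 1) * σ)))}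
    (hS : ∀ v, ¬ S ⊆ readBlock τ α σ v) : fourierCoeff (ADtta τ α σ) S = 0 := by
  have hne : S ≠ ∅ := by rintro rfl; simp at hS
  rw [fourierCoeff_ADtta, if_neg hne]
  simp [hS]

/-- Each coefficient on a set contained in some `readBlock` is at least `2 / (t a)` in absolute
value. -/
lemma le_abs_fourierCoeff_ADtta (hσ : 1 ≤ σ) (hα : 2 * 2 ^ σ ≤ 2 ^ α)
    {S : Finset (Fin (τ + (α + (2 ^ τ - 1) * σ)))} {v : Fin τ → Bool}
    (hv : S ⊆ readBlock τ α σ v) :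
    2 / (2 ^ τ * 2 ^ α) ≤ |fourierCoeff (ADtta τ α σ) S| := by
  have hα' : (2 : ℝ) * 2 ^ σ ≤ 2 ^ α := by exact_mod_cast hα
  have hs0 : (0 : ℝ) < 2 ^ σ := by positivity
  by_cases hS : S ⊆ addrBlock τ α σ
  · have h1 : (1 : ℝ) / 2 ^ α ≤ 1 / 2 ^ σ - 1 / 2 ^ α := by
      have : 2 * (1 / 2 ^ α : ℝ) ≤ 1 / 2 ^ σ := by
        rw [mul_one_div, div_le_div_iff₀ (by positivity) (by positivity)]
        linarith
      linarith
    have h2 : 2 / (2 ^ τ * 2 ^ α : ℝ) ≤ 2 / 2 ^ τ * (1 / 2 ^ σ - 1 / 2 ^ α) := by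
      calc 2 / (2 ^ τ * 2 ^ α : ℝ) = 2 / 2 ^ τ * (1 / 2 ^ α) := by field_simp
        _ ≤ _ := by gcongr
    refine le_trans ?_ (le_abs_self _)
    rw [fourierCoeff_ADtta_addr hS]
    have h3 : (0 : ℝ) ≤ if S = ∅ then 1 - 2 / 2 ^ σ else 0 := by
      split_ifs
      · have : (2 : ℝ) ^ 1 ≤ 2 ^ σ := pow_le_pow_right₀ (by norm_num) hσ
        rw [sub_nonneg, div_le_one hs0]
        linarith
      · exact le_rfl
    linarith
  · rw [abs_fourierCoeff_ADtta_target hS hv]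
    split_ifs
    · exact le_rfl
    · have h4 : (2 : ℝ) ^ σ ≤ 2 ^ α := by linarith
      exact div_le_div_of_nonneg_left (by norm_num) (by positivity)
        (mul_le_mul_of_nonneg_left h4 (by positivity))

lemma mem_fourierSupport_ADtta (hσ : 1 ≤ σ) (hα : 2 * 2 ^ σ ≤ 2 ^ α)
    {S : Finset (Fin (τ + (α + (2 ^ τ - 1) * σ)))} :
    S ∈ fourierSupport (ADtta τ α σ) ↔ ∃ v, S ⊆ readBlock τ α σ v := by
  rw [fourierSupport, mem_filter, and_iff_right (mem_univ _)]
  constructor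
  · intro h
    by_contra! h'
    exact h (fourierCoeff_ADtta_eq_zero h')
  · rintro ⟨v, hv⟩ h
    have := le_abs_fourierCoeff_ADtta hσ hα hv
    rw [h, abs_zero] at this
    exact absurd this (not_le.2 (by positivity))

lemma span_fourierSupport_ADtta (hσ : 1 ≤ σ) (hα : 2 * 2 ^ σ ≤ 2 ^ α) :
    Submodule.span (ZMod 2)
      (indicatorVec '' (fourierSupport (ADtta τ α σ) :
        Set (Finset (Fin (τ + (α + (2 ^ τ - 1) * σ)))))) = ⊤ := by
  rw [eq_top_iff, ← (Pi.basisFun (ZMod 2) _).span_eq, Submodule.span_le]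
  rintro _ ⟨i, rfl⟩
  refine Submodule.subset_span ⟨{i}, ?_, ?_⟩
  · rw [mem_coe, mem_fourierSupport_ADtta hσ hα]
    by_cases hi : i ∈ addrBlock τ α σ
    · exact ⟨fun _ => false, by simp [readBlock, hi]⟩
    · obtain ⟨v, hv⟩ := exists_mem_targetBlock hi
      exact ⟨v, by simp [readBlock, hv]⟩
  · funext j
    simp [indicatorVec, Pi.single_apply]

lemma fourierRank_ADtta (hσ : 1 ≤ σ) (hα : 2 * 2 ^ σ ≤ 2 ^ α) :
    fourierRank (ADtta τ α σ) = τ + (α + (2 ^ τ - 1) * σ) := by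
  rw [fourierRank, span_fourierSupport_ADtta hσ hα, finrank_top, Module.finrank_fin_fun]

lemma sparsity_ADtta (hσ : 1 ≤ σ) (hα : 2 * 2 ^ σ ≤ 2 ^ α) :
    sparsity (ADtta τ α σ) = (2 ^ τ - 1) * (2 ^ σ - 1) * 2 ^ τ + 2 ^ τ * 2 ^ α := by
  have h1 : fourierSupport (ADtta τ α σ) = (addrBlock τ α σ).powerset ∪
      univ.biUnion fun v => (readBlock τ α σ v).powerset \ (addrBlock τ α σ).powerset := by
    ext S
    rw [mem_fourierSupport_ADtta hσ hα]
    simp only [mem_union, mem_powerset, mem_biUnion, mem_univ, true_and, mem_sdiff]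
    constructor
    · rintro ⟨v, hv⟩
      by_cases hS : S ⊆ addrBlock τ α σ
      · exact Or.inl hS
      · exact Or.inr ⟨v, hv, hS⟩
    · rintro (h | ⟨v, hv, -⟩)
      · exact ⟨fun _ => false, h.trans subset_union_left⟩
      · exact ⟨v, hv⟩
  have h2 : ∀ v, ((readBlock τ α σ v).powerset \ (addrBlock τ α σ).powerset).card =
      2 ^ τ * ((2 ^ σ - 1) +
        if v = fun _ => false then 2 ^ α - 2 ^ σ else 0) := by
    intro v
    have hsub : addrBlock τ α σ ⊆ readBlock τ α σ v := subset_union_left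
    rw [Finset.card_sdiff_of_subset (powerset_mono.2 hsub), card_powerset,
      card_powerset, card_readBlock, card_addrBlock, pow_add]
    have : 1 ≤ 2 ^ σ := Nat.one_le_two_pow
    have h3 : 2 ^ σ ≤ 2 ^ α := by omega
    split_ifs
    · rw [show 2 ^ σ - 1 + (2 ^ α - 2 ^ σ) = 2 ^ α - 1 by omega, Nat.mul_sub, mul_one]
    · rw [add_zero, Nat.mul_sub, mul_one]
  rw [sparsity, h1, Finset.card_union_of_disjoint, Finset.card_biUnion, card_powerset,
    card_addrBlock]
  · simp_rw [h2]
    rw [← Finset.mul_sum, Finset.sum_add_distrib, Finset.sum_ite_eq']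
    simp only [mem_univ, if_true, sum_const, card_univ, Fintype.card_fun, Fintype.card_bool,
      Fintype.card_fin, smul_eq_mul]
    have h4 : 1 ≤ 2 ^ σ := Nat.one_le_two_pow
    have h5 : 1 ≤ 2 ^ τ := Nat.one_le_two_pow
    have h3 : 2 ^ σ ≤ 2 ^ α := by omega
    zify [h3, h4, h5]
    ring
  · intro u _ v _ huv
    rw [Function.onFun, Finset.disjoint_left]
    intro S hu hv
    simp only [mem_sdiff, mem_powerset] at hu hv
    obtain ⟨i, hi, hi'⟩ := Finset.not_subset.1 hu.2
    have h1 := hu.1 hi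
    have h2 := hv.1 hi
    simp only [readBlock, mem_union, hi', false_or] at h1 h2
    exact huv (eq_of_mem_targetBlock h1 h2)
  · rw [Finset.disjoint_left]
    intro S hS h
    simp only [mem_biUnion, mem_sdiff] at h
    obtain ⟨v, -, -, h⟩ := h
    exact h hS

lemma exists_mem_targetBlock_false (hα : 1 ≤ α) :
    ∃ i, i ∈ targetBlock τ α σ fun _ => false := by
  apply Finset.card_pos.1
  rw [card_targetBlock, if_pos rfl]
  omega

/-- A coordinate of the large target occurs only in coefficients of absolute value at most
`2 / (t a)`. -/
lemma abs_fourierCoeff_ADtta_of_mem {i : Fin (τ + (α + (2 ^ τ - 1) * σ))}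
    (hi : i ∈ targetBlock τ α σ fun _ => false)
    {S : Finset (Fin (τ + (α + (2 ^ τ - 1) * σ)))} (hS : i ∈ S) :
    |fourierCoeff (ADtta τ α σ) S| ≤ 2 / (2 ^ τ * 2 ^ α) := by
  have hi' : i ∉ addrBlock τ α σ := Finset.disjoint_right.1 (disjoint_addrBlock_targetBlock _) hi
  by_cases h : ∃ v, S ⊆ readBlock τ α σ v
  · obtain ⟨v, hv⟩ := h
    have h1 := hv hS
    simp only [readBlock, mem_union, hi', false_or] at h1
    rw [abs_fourierCoeff_ADtta_target (fun h => hi' (h hS)) hv,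
      if_pos (eq_of_mem_targetBlock h1 hi)]
  · rw [fourierCoeff_ADtta_eq_zero (not_exists.1 h), abs_zero]
    positivity

lemma maxSuppEntropy_ADtta (hσ : 1 ≤ σ) (hα : 2 * 2 ^ σ ≤ 2 ^ α) (hα' : 1 ≤ α) :
    maxSuppEntropy (ADtta τ α σ) = (2 ^ τ : ℝ) * 2 ^ α / 2 := by
  refine IsGreatest.csSup_eq ⟨?_, ?_⟩
  · obtain ⟨i, hi⟩ := exists_mem_targetBlock_false (τ := τ) (σ := σ) hα'
    have hi' : {i} ⊆ readBlock τ α σ fun _ => false := by simp [readBlock, hi]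
    refine ⟨{i}, (mem_fourierSupport_ADtta hσ hα).2 ⟨_, hi'⟩, ?_⟩
    have : |fourierCoeff (ADtta τ α σ) {i}| = 2 / (2 ^ τ * 2 ^ α) :=
      le_antisymm (abs_fourierCoeff_ADtta_of_mem hi (mem_singleton_self i))
        (le_abs_fourierCoeff_ADtta hσ hα hi')
    simp only [this, one_div_div]
  · rintro _ ⟨S, hS, rfl⟩
    obtain ⟨v, hv⟩ := (mem_fourierSupport_ADtta hσ hα).1 hS
    have := le_abs_fourierCoeff_ADtta hσ hα hv
    rw [← one_div_div]
    exact one_div_le_one_div_of_le (by positivity) this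

lemma maxRankEntropy_ADtta (hσ : 1 ≤ σ) (hα : 2 * 2 ^ σ ≤ 2 ^ α) (hα' : 1 ≤ α) :
    maxRankEntropy (ADtta τ α σ) = (2 ^ τ : ℝ) * 2 ^ α / 2 := by
  refine IsLeast.csInf_eq ⟨⟨by positivity, ?_⟩, ?_⟩
  · have : {S | 1 / ((2 ^ τ : ℝ) * 2 ^ α / 2) ≤ |fourierCoeff (ADtta τ α σ) S|} =
        (fourierSupport (ADtta τ α σ) :
          Set (Finset (Fin (τ + (α + (2 ^ τ - 1) * σ))))) := by
      ext S
      rw [Set.mem_ofPred_eq, mem_coe, one_div_div]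
      constructor
      · intro h
        rw [fourierSupport, mem_filter, and_iff_right (mem_univ _)]
        intro h0
        rw [h0, abs_zero] at h
        exact absurd h (not_le.2 (by positivity))
      · intro h
        obtain ⟨v, hv⟩ := (mem_fourierSupport_ADtta hσ hα).1 h
        exact le_abs_fourierCoeff_ADtta hσ hα hv
    rw [levelDim, this, fourierRank]
  · rintro t ⟨ht, hdim⟩
    by_contra! hlt
    obtain ⟨i, hi⟩ := exists_mem_targetBlock_false (τ := τ) (σ := σ) hα'
    have hle : Submodule.span (ZMod 2)
        (indicatorVec '' {S | 1 / t ≤ |fourierCoeff (ADtta τ α σ) S|}) ≤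
        LinearMap.ker (LinearMap.proj i :
          (Fin (τ + (α + (2 ^ τ - 1) * σ)) → ZMod 2) →ₗ[ZMod 2] ZMod 2) := by
      rw [Submodule.span_le]
      rintro _ ⟨S, hS, rfl⟩
      have hiS : i ∉ S := by
        intro h
        have h1 := (show 1 / t ≤ _ from hS).trans (abs_fourierCoeff_ADtta_of_mem hi h)
        rw [← one_div_div ((2 : ℝ) ^ τ * 2 ^ α), one_div_le_one_div ht (by positivity)] at h1
        linarith
      simp [indicatorVec, hiS]
    rw [levelDim, fourierRank_ADtta hσ hα] at hdim
    have htop := Submodule.eq_top_of_finrank_eq (hdim.trans (Module.finrank_fin_fun _).symm)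
    rw [htop] at hle
    have h1 := hle (Submodule.mem_top (x := fun _ => 1))
    simp at h1

lemma weight_ADtta :
    weight (ADtta τ α σ) =
      1 / (2 ^ σ : ℝ) + 1 / ((2 ^ α : ℝ) * 2 ^ τ) - 1 / ((2 ^ τ : ℝ) * 2 ^ σ) := by
  have hval : ∀ x, ADtta τ α σ x = 1 ∨ ADtta τ α σ x = -1 := by
    intro x
    simp only [ADtta]
    split_ifs <;> simp
  have h1 : weight (ADtta τ α σ) = (1 - fourierCoeff (ADtta τ α σ) ∅) / 2 := by
    have h2 : ∀ x, (if ADtta τ α σ x = -1 then (1 : ℝ) else 0) = (1 - ADtta τ α σ x) / 2 := by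
      intro x
      rcases hval x with h | h <;> rw [h] <;> norm_num
    rw [weight, ← Finset.sum_boole]
    simp_rw [h2]
    rw [← Finset.sum_div, Finset.sum_sub_distrib, fourierCoeff]
    simp only [sum_const, card_univ, Fintype.card_fun, Fintype.card_bool, Fintype.card_fin,
      prod_empty, mul_one, nsmul_eq_mul, Nat.cast_pow, Nat.cast_ofNat]
    field_simp
  rw [h1, fourierCoeff_ADtta_addr (empty_subset _), if_pos rfl]
  field_simp
  ring

end Measures

/-- **Claim (properties of `AD_{t,t',a}`).** For powers of two `t = 2^τ ≥ 2`,
`t' = 2^σ ≥ 2` and `a = 2^α ≥ 2t'`, the function `AD_{t,t',a}` satisfies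
`r = (t-1)·log t' + log a + log t`, `k = (t-1)(t'-1)t + t·a`, `k' = k'' = t·a/2`, and
`δ = 1/t' + 1/(a·t) - 1/(t·t')`. -/
theorem ADtta_measures (τ α σ : ℕ) (hτ : 1 ≤ τ) (hσ : 1 ≤ σ)
    (hα : 2 * 2 ^ σ ≤ 2 ^ α) :
    fourierRank (ADtta τ α σ) = (2 ^ τ - 1) * σ + α + τ ∧
    sparsity (ADtta τ α σ) = (2 ^ τ - 1) * (2 ^ σ - 1) * 2 ^ τ + 2 ^ τ * 2 ^ α ∧
    maxSuppEntropy (ADtta τ α σ) = (2 ^ τ : ℝ) * 2 ^ α / 2 ∧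
    maxRankEntropy (ADtta τ α σ) = (2 ^ τ : ℝ) * 2 ^ α / 2 ∧
    weight (ADtta τ α σ) =
      1 / (2 ^ σ : ℝ) + 1 / ((2 ^ α : ℝ) * 2 ^ τ) - 1 / ((2 ^ τ : ℝ) * 2 ^ σ) := by
  have hα' : 1 ≤ α := by
    rcases Nat.eq_zero_or_pos α with rfl | h
    · have : 1 ≤ 2 ^ σ := Nat.one_le_two_pow
      omega
    · exact h
  refine ⟨?_, sparsity_ADtta hσ hα, maxSuppEntropy_ADtta hσ hα hα',
    maxRankEntropy_ADtta hσ hα hα', weight_ADtta⟩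
  rw [fourierRank_ADtta hσ hα]
  ring

end BoolFunc

end
end

section
/- For every constant ε > 0 there exist constants c₁,…,c₈ > 0 and κ₀ such that: for all integers ρ, κ, κ' with κ ≥ κ₀, log κ ≤ ρ ≤ κ^{1/2−ε} and κ^{1/2} ≤ κ' ≤ κ, there exists a positive integer n and a Boolean function f : {-1,1}^n → {-1,1} satisfying c₁ρ ≤ r(f) ≤ c₂ρ, c₃κ ≤ k(f) ≤ c₄κ, c₅κ' ≤ k'(f) ≤ c₆κ', and c₇·M ≤ δ(f) ≤ c₈·M, where M = max{ ρ²/(κ·(log κ)²) , κ/κ'² }. -/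
open scoped BigOperators
open scoped Classical

noncomputable section

namespace BoolFunc

/-- The Fourier coefficient at `s`, as a linear functional on functions on the cube `ι → Bool`. -/
def hat {ι : Type*} [Fintype ι] [DecidableEq ι] (s : ι → Bool) : ((ι → Bool) → ℝ) →ₗ[ℝ] ℝ :=
  ((2 : ℝ) ^ Fintype.card ι)⁻¹ •
    ∑ x : ι → Bool, (∏ i, if s i then signv (x i) else 1) • LinearMap.proj x

/-- The Fourier coefficient at `b` of a function of one bit. -/
def bitCoeff (g : Bool → ℝ) (b : Bool) : ℝ := (g false + (if b then -1 else 1) * g true) / 2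

section Cube

variable {ι : Type*} [Fintype ι] [DecidableEq ι]

lemma hat_apply (s : ι → Bool) (F : (ι → Bool) → ℝ) :
    hat s F = (∑ x, F x * ∏ i, if s i then signv (x i) else 1) / 2 ^ Fintype.card ι := by
  simp [hat, div_eq_inv_mul, mul_comm]

lemma hat_prod (s : ι → Bool) (g : ι → Bool → ℝ) :
    hat s (fun x => ∏ i, g i (x i)) = ∏ i, bitCoeff (g i) (s i) := by
  have h : ∀ i, bitCoeff (g i) (s i) =
      (∑ b : Bool, g i b * (if s i then signv b else 1)) / 2 := by
    intro i
    cases h : s i <;> simp [bitCoeff, signv] <;> ring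
  simp_rw [hat_apply, h, Finset.prod_div_distrib, Finset.prod_univ_sum, ← Finset.prod_mul_distrib]
  simp [-Fintype.univ_bool]

/-- Relabel the coordinates of a function by `Fin n`. -/
def relabel (F : (ι → Bool) → ℝ) : (Fin (Fintype.card ι) → Bool) → ℝ :=
  fun x => F (fun i => x (Fintype.equivFin ι i))

/-- Subsets of `Fin n` as characteristic functions on the original coordinates. -/
def charEquiv : Finset (Fin (Fintype.card ι)) ≃ (ι → Bool) where
  toFun S i := decide (Fintype.equivFin ι i ∈ S)
  invFun s := Finset.univ.filter fun j => s ((Fintype.equivFin ι).symm j) = true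
  left_inv S := by ext; simp
  right_inv s := by ext; simp

lemma fourierCoeff_relabel (F : (ι → Bool) → ℝ) (S : Finset (Fin (Fintype.card ι))) :
    fourierCoeff (relabel F) S = hat (charEquiv S) F := by
  rw [hat_apply, fourierCoeff]
  congr 1
  refine Fintype.sum_equiv ((Fintype.equivFin ι).symm.arrowCongr (Equiv.refl Bool)) _ _ fun x => ?_
  have h : ∏ i ∈ S, signv (x i) = ∏ j, if j ∈ S then signv (x j) else 1 := by simp
  rw [h, ← Equiv.prod_comp (Fintype.equivFin ι)]
  simp [relabel, charEquiv, Equiv.arrowCongr, Function.comp_def]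

lemma sparsity_relabel (F : (ι → Bool) → ℝ) :
    sparsity (relabel F) = (Finset.univ.filter fun s => hat s F ≠ 0).card := by
  unfold sparsity fourierSupport
  refine Finset.card_equiv charEquiv fun S => ?_
  simp [fourierCoeff_relabel]

lemma weight_relabel {F : (ι → Bool) → ℝ} (hF : ∀ x, F x = 1 ∨ F x = -1) :
    weight (relabel F) = (1 - hat (fun _ => false) F) / 2 := by
  have h0 : hat (fun _ => false) F = fourierCoeff (relabel F) ∅ := by
    rw [fourierCoeff_relabel]
    congr
  have h1 : ∀ x, relabel F x = 1 - 2 * (if relabel F x = -1 then 1 else 0) := by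
    intro x
    rcases hF (fun i => x (Fintype.equivFin ι i)) with h | h <;> norm_num [relabel, h]
  rw [h0, weight, fourierCoeff]
  simp only [Finset.prod_empty, mul_one]
  rw [Finset.sum_congr rfl fun x _ => h1 x, Finset.sum_sub_distrib, ← Finset.mul_sum,
    Finset.sum_boole]
  simp
  field_simp
  ring

lemma fourierRank_le {n : ℕ} (f : (Fin n → Bool) → ℝ) : fourierRank f ≤ n :=
  (Submodule.finrank_le _).trans (by simp)

lemma card_le_fourierRank_relabel {κ : Type*} [Fintype κ] (F : (ι → Bool) → ℝ) (j : κ → ι)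
    (hj : Function.Injective j) (h : ∀ k, hat (fun i => decide (i = j k)) F ≠ 0) :
    Fintype.card κ ≤ fourierRank (relabel F) := by
  have hli : LinearIndependent (ZMod 2) fun k : κ =>
      (Pi.single (Fintype.equivFin ι (j k)) 1 : Fin (Fintype.card ι) → ZMod 2) :=
    (Pi.linearIndependent_single_one (Fin (Fintype.card ι)) (ZMod 2)).comp
      (fun k => Fintype.equivFin ι (j k)) ((Fintype.equivFin ι).injective.comp hj)
  rw [← finrank_span_eq_card hli]
  refine Submodule.finrank_mono (Submodule.span_mono ?_)
  rintro _ ⟨k, rfl⟩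
  refine ⟨{Fintype.equivFin ι (j k)}, ?_, ?_⟩
  · simpa [fourierSupport, fourierCoeff_relabel, charEquiv] using h k
  · ext i
    simp [indicatorVec, Pi.single_apply]

lemma maxSuppEntropy_relabel {F : (ι → Bool) → ℝ} {K : ℝ} (hK : 0 < K) (s : ι → Bool)
    (hs : |hat s F| = 1 / K) (h : ∀ s, hat s F ≠ 0 → 1 / K ≤ |hat s F|) :
    maxSuppEntropy (relabel F) = K := by
  refine IsGreatest.csSup_eq ⟨⟨charEquiv.symm s, ?_, ?_⟩, ?_⟩
  · simp only [fourierSupport, Finset.coe_filter, Finset.mem_univ, true_and, Set.mem_ofPred_eq,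
      fourierCoeff_relabel, Equiv.apply_symm_apply, ← abs_pos, hs]
    positivity
  · simp [fourierCoeff_relabel, hs]
  · rintro _ ⟨S, hS, rfl⟩
    have hS' : hat (charEquiv S) F ≠ 0 := by
      simpa [fourierSupport, fourierCoeff_relabel] using hS
    simp only [fourierCoeff_relabel]
    rw [div_le_iff₀ (abs_pos.mpr hS'), ← div_le_iff₀' hK]
    exact h _ hS'

end Cube

/-- The `{0,1}`-valued indicator of a bit. -/
def bitInd (b c : Bool) : ℝ := if c = b then 1 else 0

/-- The coordinates of `selector`: a selecting bit, a sign bit and `p` guard bits; the two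
arguments of an inner product of length `s`; an address of length `a` and, for each address, a
block of `m` bits. -/
abbrev Coord (p s a m : ℕ) :=
  (Unit ⊕ Unit ⊕ Fin p) ⊕ (Fin s ⊕ Fin s) ⊕ (Fin a ⊕ (Fin a → Bool) × Fin m)

section Selector

variable {p s a m : ℕ}

/-- Coordinate factors depending only on the part a coordinate belongs to. -/
def factors (t u w : Bool → ℝ) (y z : Fin s → Bool → ℝ) (q : Fin a → Bool → ℝ)
    (l : (Fin a → Bool) → Bool → ℝ) : Coord p s a m → Bool → ℝ :=
  Sum.elim (Sum.elim (fun _ => t) (Sum.elim (fun _ => u) fun _ => w))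
    (Sum.elim (Sum.elim y z) (Sum.elim q fun l' => l l'.1))

/-- The indicator of the selecting bit and all guard bits being `true`. -/
def guardFactors : Coord p s a m → Bool → ℝ :=
  factors (bitInd true) 1 (bitInd true) 1 1 1 1

/-- The guard indicator, times the indicator of the first inner-product argument being `v`, times
the sign bit and the character `v` of the second argument. -/
def innerFactors (v : Fin s → Bool) : Coord p s a m → Bool → ℝ :=
  factors (bitInd true) signv (bitInd true) (fun i => bitInd (v i))
    (fun i => if v i then signv else 1) 1 1

/-- The indicator of the selecting bit being `false`, the address being `b`, and all the bits of
block `b` being `true`. -/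
def blockFactors (b : Fin a → Bool) : Coord p s a m → Bool → ℝ :=
  factors (bitInd false) 1 1 1 1 (fun i => bitInd (b i))
    fun b' => if b' = b then bitInd true else 1

/-- If the selecting bit is `true`, a guarded signed inner-product function; otherwise an
addressing function whose leaves are conjunctions of disjoint blocks of bits. -/
def selector (p s a m : ℕ) : (Coord p s a m → Bool) → ℝ :=
  1 - (fun x => ∏ i, guardFactors i (x i)) + (∑ v, fun x => ∏ i, innerFactors v i (x i))
    - (2 : ℝ) • ∑ b, fun x => ∏ i, blockFactors b i (x i)

lemma prod_bitInd {ι : Type*} [Fintype ι] (b c : ι → Bool) :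
    ∏ i, bitInd (b i) (c i) = if c = b then 1 else 0 := by
  simp [bitInd, Finset.prod_ite_zero, funext_iff]

lemma signv_eq (b : Bool) : signv b = 1 ∨ signv b = -1 := by
  cases b <;> simp [signv]

lemma prod_eq_one_or_neg_one {ι : Type*} (S : Finset ι) (g : ι → ℝ)
    (h : ∀ i ∈ S, g i = 1 ∨ g i = -1) : ∏ i ∈ S, g i = 1 ∨ ∏ i ∈ S, g i = -1 := by
  refine Finset.prod_induction g (fun r => r = 1 ∨ r = -1) ?_ (Or.inl rfl) h
  rintro _ _ (rfl | rfl) (rfl | rfl) <;> norm_num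

lemma prod_factors (φ : (Bool → ℝ) → Bool → ℝ) (t u w : Bool → ℝ) (y z : Fin s → Bool → ℝ)
    (q : Fin a → Bool → ℝ) (l : (Fin a → Bool) → Bool → ℝ) (x : Coord p s a m → Bool) :
    ∏ i, φ (factors t u w y z q l i) (x i) =
      φ t (x (.inl (.inl ()))) * (φ u (x (.inl (.inr (.inl ())))) *
          ∏ i, φ w (x (.inl (.inr (.inr i))))) *
        ((∏ i, φ (y i) (x (.inr (.inl (.inl i))))) * ∏ i, φ (z i) (x (.inr (.inl (.inr i))))) *
        ((∏ i, φ (q i) (x (.inr (.inr (.inl i))))) *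
          ∏ b, ∏ i, φ (l b) (x (.inr (.inr (.inr (b, i)))))) := by
  simp [factors, Fintype.prod_sum_type, Fintype.prod_prod_type, mul_assoc]

lemma guardFactors_eval (x : Coord p s a m → Bool) : ∏ i, guardFactors i (x i) =
    bitInd true (x (.inl (.inl ()))) * ∏ i, bitInd true (x (.inl (.inr (.inr i)))) := by
  refine (prod_factors (fun g => g) _ _ _ _ _ _ _ x).trans ?_
  simp

lemma sum_innerFactors_eval (x : Coord p s a m → Bool) : ∑ v, ∏ i, innerFactors v i (x i) =
    bitInd true (x (.inl (.inl ()))) * (signv (x (.inl (.inr (.inl ())))) *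
      ∏ i, bitInd true (x (.inl (.inr (.inr i))))) *
      ∏ i, (if x (.inr (.inl (.inl i))) then signv (x (.inr (.inl (.inr i)))) else 1) := by
  rw [Finset.sum_eq_single fun i => x (.inr (.inl (.inl i)))]
  · refine (prod_factors (fun g => g) _ _ _ _ _ _ _ x).trans ?_
    simp [prod_bitInd (fun i => x (.inr (.inl (.inl i)))), ite_apply]
  · intro v _ hv
    refine (prod_factors (fun g => g) _ _ _ _ _ _ _ x).trans ?_
    simp [prod_bitInd v, hv.symm]
  · simp

lemma sum_blockFactors_eval (x : Coord p s a m → Bool) : ∑ b, ∏ i, blockFactors b i (x i) =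
    bitInd false (x (.inl (.inl ()))) * ∏ i, bitInd true
      (x (.inr (.inr (.inr (fun i => x (.inr (.inr (.inl i))), i))))) := by
  rw [Finset.sum_eq_single fun i => x (.inr (.inr (.inl i)))]
  · refine (prod_factors (fun g => g) _ _ _ _ _ _ _ x).trans ?_
    rw [Finset.prod_eq_single (fun i => x (.inr (.inr (.inl i)))) _ (by simp)]
    · simp [prod_bitInd (fun i => x (.inr (.inr (.inl i))))]
    · intro b _ hb
      simp [hb]
  · intro b _ hb
    refine (prod_factors (fun g => g) _ _ _ _ _ _ _ x).trans ?_
    simp [prod_bitInd b, hb.symm]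
  · simp

lemma selector_eq (x : Coord p s a m → Bool) :
    selector p s a m x = 1 ∨ selector p s a m x = -1 := by
  have hind (ι : Type) [Fintype ι] (c : ι → Bool) :
      ∏ i, bitInd true (c i) = 0 ∨ ∏ i, bitInd true (c i) = 1 := by
    rw [prod_bitInd fun _ => true]
    split_ifs <;> simp
  simp only [selector, Pi.add_apply, Pi.sub_apply, Pi.smul_apply, Finset.sum_apply, Pi.one_apply,
    guardFactors_eval, sum_innerFactors_eval, sum_blockFactors_eval]
  cases x (.inl (.inl ()))
  · rcases hind _ fun i => x (.inr (.inr (.inr (fun i => x (.inr (.inr (.inl i))), i)))) with h | h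
      <;> rw [h] <;> norm_num [bitInd]
  · have hz := prod_eq_one_or_neg_one Finset.univ (fun i => if x (.inr (.inl (.inl i))) then
      signv (x (.inr (.inl (.inr i)))) else 1) fun i _ => by
        split_ifs
        · exact signv_eq _
        · simp
    have h0 : bitInd false true = 0 := by simp [bitInd]
    have h1 : bitInd true true = 1 := by simp [bitInd]
    rcases hind _ fun i => x (.inl (.inr (.inr i))) with h | h
    · simp [h, h0]
    · rw [h]
      rcases hz with hz | hz <;> rw [hz] <;>
        rcases signv_eq (x (.inl (.inr (.inl ())))) with hu | hu <;>
        simp [hu, h0, h1]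

lemma hat_selector (S : Coord p s a m → Bool) :
    hat S (selector p s a m) = (∏ i, bitCoeff 1 (S i)) - ∏ i, bitCoeff (guardFactors i) (S i) +
      ∑ v, ∏ i, bitCoeff (innerFactors v i) (S i) -
      2 * ∑ b, ∏ i, bitCoeff (blockFactors b i) (S i) := by
  have h1 : (1 : (Coord p s a m → Bool) → ℝ) = fun x => ∏ i, (1 : Bool → ℝ) (x i) := by
    ext; simp
  simp only [selector, map_sub, map_add, map_sum, map_smul, hat_prod, smul_eq_mul]
  rw [h1, hat_prod]

lemma bitCoeff_one (b : Bool) : bitCoeff 1 b = if b then 0 else 1 := by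
  cases b <;> norm_num [bitCoeff]

lemma bitCoeff_bitInd (c b : Bool) : bitCoeff (bitInd c) b = (if b && c then -1 else 1) / 2 := by
  cases b <;> cases c <;> norm_num [bitCoeff, bitInd]

lemma bitCoeff_bitInd_ne_zero (c b : Bool) : bitCoeff (bitInd c) b ≠ 0 := by
  rw [bitCoeff_bitInd]
  split_ifs <;> norm_num

lemma abs_bitCoeff_bitInd (c b : Bool) : |bitCoeff (bitInd c) b| = 1 / 2 := by
  rw [bitCoeff_bitInd]
  split_ifs <;> norm_num [abs_of_neg]

lemma bitCoeff_signv (b : Bool) : bitCoeff signv b = if b then 1 else 0 := by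
  cases b <;> norm_num [bitCoeff, signv]

lemma prod_bitCoeff_eq_zero {ι : Type*} [Fintype ι] {g : ι → Bool → ℝ} {S : ι → Bool} (i : ι)
    (hg : g i = 1) (hS : S i = true) : ∏ i, bitCoeff (g i) (S i) = 0 :=
  Finset.prod_eq_zero (Finset.mem_univ i) (by simp [hg, hS, bitCoeff_one])

lemma blockFactors_of_ne {b b' : Fin a → Bool} (h : b' ≠ b) (i : Fin m) :
    blockFactors (p := p) (s := s) b (.inr (.inr (.inr (b', i)))) = 1 := by
  simp [blockFactors, factors, h]

lemma support_selector {S : Coord p s a m → Bool} (hS : hat S (selector p s a m) ≠ 0) :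
    (∀ i, S (.inr (.inr i)) = false) ∨
      ∃ b, (∀ i, S (.inl (.inr i)) = false) ∧ (∀ i, S (.inr (.inl i)) = false) ∧
        ∀ b' ≠ b, ∀ i, S (.inr (.inr (.inr (b', i)))) = false := by
  by_contra! h
  obtain ⟨⟨i, hi⟩, h⟩ := h
  replace hi := eq_true_of_ne_false hi
  refine hS ?_
  rw [hat_selector, prod_bitCoeff_eq_zero (.inr (.inr i)) rfl hi,
    prod_bitCoeff_eq_zero (.inr (.inr i)) (by cases i <;> rfl) hi,
    Finset.sum_eq_zero fun v _ => prod_bitCoeff_eq_zero (.inr (.inr i)) (by cases i <;> rfl) hi,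
    Finset.sum_eq_zero]
  · simp
  intro b _
  by_contra hb
  have hne : ∀ i, blockFactors b i = 1 → S i = false := fun i hi => by
    by_contra hSi
    exact hb (prod_bitCoeff_eq_zero i hi (by simpa using hSi))
  obtain ⟨b', hb', j, hj⟩ := h b (fun i => hne _ (by rcases i with i | i <;> rfl))
    (fun i => hne _ (by rcases i with i | i <;> rfl))
  exact hj (hne _ (blockFactors_of_ne hb' j))

lemma card_support_selector_le :
    (Finset.univ.filter fun S : Coord p s a m → Bool => hat S (selector p s a m) ≠ 0).card ≤
      2 ^ (2 + p + 2 * s) + 2 ^ (1 + 2 * a + m) := by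
  let A : ((Unit ⊕ Unit ⊕ Fin p) → Bool) × ((Fin s ⊕ Fin s) → Bool) → Coord p s a m → Bool :=
    fun r => Sum.elim r.1 (Sum.elim r.2 fun _ => false)
  let B : Bool × (Fin a → Bool) × (Fin a → Bool) × (Fin m → Bool) → Coord p s a m → Bool :=
    fun r => Sum.elim (Sum.elim (fun _ => r.1) fun _ => false) (Sum.elim (fun _ => false)
      (Sum.elim r.2.1 fun l => if l.1 = r.2.2.1 then r.2.2.2 l.2 else false))
  have hsub : (Finset.univ.filter fun S : Coord p s a m → Bool => hat S (selector p s a m) ≠ 0) ⊆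
      Finset.univ.image A ∪ Finset.univ.image B := by
    intro S hS
    rw [Finset.mem_union, Finset.mem_image, Finset.mem_image]
    rcases support_selector (Finset.mem_filter.mp hS).2 with h | ⟨b, h1, h2, h3⟩
    · refine Or.inl ⟨(fun i => S (.inl i), fun i => S (.inr (.inl i))), Finset.mem_univ _, ?_⟩
      ext (i | i | i) <;> simp [A, h]
    · refine Or.inr ⟨(S (.inl (.inl ())), fun i => S (.inr (.inr (.inl i))), b,
        fun i => S (.inr (.inr (.inr (b, i))))), Finset.mem_univ _, ?_⟩
      ext ((i | i) | i | i | ⟨b', i⟩)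
      · rfl
      · simp [B, h1]
      · simp [B, h2]
      · rfl
      · by_cases hb : b' = b
        · simp [B, hb]
        · simp [B, hb, h3]
  refine (Finset.card_le_card hsub).trans ((Finset.card_union_le _ _).trans
    (add_le_add (Finset.card_image_le.trans ?_) (Finset.card_image_le.trans ?_)))
  · simp only [Finset.card_univ, Fintype.card_prod, Fintype.card_fun, Fintype.card_bool,
      Fintype.card_sum, Fintype.card_fin, Fintype.card_unit, ← pow_add]
    exact Nat.pow_le_pow_right two_pos (by omega)
  · simp only [Finset.card_univ, Fintype.card_prod, Fintype.card_fun, Fintype.card_bool,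
      Fintype.card_fin, ← pow_add, ← pow_succ']
    exact Nat.pow_le_pow_right two_pos (by omega)

lemma abs_hat_selector {S : Coord p s a m → Bool} (hu : S (.inl (.inr (.inl ()))) = true)
    (h : ∀ i, S (.inr (.inr i)) = false) :
    |hat S (selector p s a m)| = 1 / 2 ^ (1 + p + s) := by
  rw [hat_selector, prod_bitCoeff_eq_zero (g := fun _ => 1) _ rfl hu,
    prod_bitCoeff_eq_zero (g := guardFactors) _ rfl hu,
    Finset.sum_eq_zero fun b (_ : b ∈ (Finset.univ : Finset (Fin a → Bool))) =>
      prod_bitCoeff_eq_zero (g := blockFactors b) _ rfl hu,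
    Finset.sum_eq_single fun i => S (.inr (.inl (.inr i)))]
  · have hz (b : Bool) : bitCoeff (if b then signv else 1) b = 1 := by
      cases b <;> simp [bitCoeff_signv, bitCoeff_one]
    simp only [innerFactors]
    rw [prod_factors bitCoeff]
    simp [hu, h, hz, Finset.abs_prod, abs_mul, abs_bitCoeff_bitInd, bitCoeff_signv, bitCoeff_one,
      pow_add]
    ring
  · intro v _ hv
    obtain ⟨i, hi⟩ := Function.ne_iff.mp hv
    refine Finset.prod_eq_zero (Finset.mem_univ (.inr (.inl (.inr i)))) ?_
    have h1 : ∀ c d : Bool, c ≠ d → bitCoeff (if c then signv else 1) d = 0 := by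
      intro c d hcd
      cases c <;> cases d <;> simp_all [bitCoeff_signv, bitCoeff_one]
    exact h1 _ _ hi
  · simp

lemma le_card_support_selector :
    2 ^ (1 + p + 2 * s) ≤
      (Finset.univ.filter fun S : Coord p s a m → Bool => hat S (selector p s a m) ≠ 0).card := by
  let A : Bool × (Fin p → Bool) × ((Fin s ⊕ Fin s) → Bool) → Coord p s a m → Bool :=
    fun r => Sum.elim (Sum.elim (fun _ => r.1) (Sum.elim (fun _ => true) r.2.1))
      (Sum.elim r.2.2 fun _ => false)
  have hA : Function.Injective A := by
    rintro ⟨t, w, y⟩ ⟨t', w', y'⟩ h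
    refine Prod.ext (congrFun h (.inl (.inl ()))) (Prod.ext ?_ ?_)
    · exact funext fun i => congrFun h (.inl (.inr (.inr i)))
    · exact funext fun i => congrFun h (.inr (.inl i))
  have hcard : 2 ^ (1 + p + 2 * s) = (Finset.univ.image A).card := by
    rw [Finset.card_image_of_injective _ hA]
    simp only [Finset.card_univ, Fintype.card_prod, Fintype.card_fun, Fintype.card_bool,
      Fintype.card_sum, Fintype.card_fin, ← pow_add, ← pow_succ']
    congr 1
    omega
  rw [hcard]
  refine Finset.card_le_card fun S hS => ?_
  obtain ⟨r, -, rfl⟩ := Finset.mem_image.mp hS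
  rw [Finset.mem_filter, ← abs_pos, abs_hat_selector (by rfl) fun _ => by rfl]
  exact ⟨Finset.mem_univ _, by positivity⟩

lemma hat_selector_block_ne_zero (l : (Fin a → Bool) × Fin m) :
    hat (fun i => decide (i = .inr (.inr (.inr l)))) (selector p s a m) ≠ 0 := by
  obtain ⟨b, j⟩ := l
  obtain ⟨S, hS⟩ : ∃ S : Coord p s a m → Bool,
      S = fun i => decide (i = .inr (.inr (.inr (b, j)))) := ⟨_, rfl⟩
  have hj : S (.inr (.inr (.inr (b, j)))) = true := by simp [hS]
  rw [← hS, hat_selector, prod_bitCoeff_eq_zero (g := fun _ => 1) _ rfl hj,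
    prod_bitCoeff_eq_zero (g := guardFactors) _ rfl hj,
    Finset.sum_eq_zero fun v (_ : v ∈ (Finset.univ : Finset (Fin s → Bool))) =>
      prod_bitCoeff_eq_zero (g := innerFactors v) _ rfl hj,
    Finset.sum_eq_single b]
  · have : ∏ i, bitCoeff (blockFactors (p := p) (s := s) b i) (S i) ≠ 0 := by
      rw [Finset.prod_ne_zero_iff, hS]
      rintro ((i | i | i) | (i | i) | i | ⟨b', i⟩) - <;>
        simp only [blockFactors, factors, Sum.elim_inl, Sum.elim_inr]
      any_goals exact bitCoeff_bitInd_ne_zero _ _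
      any_goals simp [bitCoeff_one]
      by_cases hb : b' = b
      · simpa [hb] using bitCoeff_bitInd_ne_zero _ _
      · simp [hb, bitCoeff_one]
    simpa using this
  · intro b' _ hb'
    exact prod_bitCoeff_eq_zero _ (blockFactors_of_ne hb'.symm j) hj
  · simp

lemma hat_selector_zero :
    hat (fun _ => false) (selector p s a m) = 1 - 1 / 2 ^ (1 + p) - 1 / 2 ^ m := by
  have hinner (v : Fin s → Bool) :
      ∏ i : Coord p s a m, bitCoeff (innerFactors v i) false = 0 :=
    Finset.prod_eq_zero (Finset.mem_univ (.inl (.inr (.inl ())))) (by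
      simp [innerFactors, factors, bitCoeff_signv])
  have hguard : ∏ i : Coord p s a m, bitCoeff (guardFactors i) false = 1 / 2 ^ (1 + p) := by
    simp only [guardFactors]
    rw [prod_factors bitCoeff _ _ _ _ _ _ _ fun _ => false]
    simp [bitCoeff_one, bitCoeff_bitInd, pow_add, mul_comm]
  have hblock (b : Fin a → Bool) :
      ∏ i : Coord p s a m, bitCoeff (blockFactors b i) false = 1 / 2 ^ (1 + a + m) := by
    simp only [blockFactors]
    rw [prod_factors bitCoeff _ _ _ _ _ _ _ fun _ => false, Finset.prod_eq_single b _ (by simp)]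
    · simp [bitCoeff_one, bitCoeff_bitInd, pow_add]
      ring
    · intro b' _ hb'
      simp [hb', bitCoeff_one]
  rw [hat_selector]
  simp only [hinner, hguard, hblock, bitCoeff_one]
  simp [pow_add]
  field_simp

/-- `r` is an integer multiple of `2 ^ (-N)`. -/
def IsDyadic (N : ℕ) (r : ℝ) : Prop := ∃ z : ℤ, r * 2 ^ N = z

namespace IsDyadic

variable {N M : ℕ} {r r' : ℝ}

lemma mono (h : IsDyadic N r) (hNM : N ≤ M) : IsDyadic M r := by
  obtain ⟨z, hz⟩ := h
  refine ⟨z * 2 ^ (M - N), ?_⟩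
  rw [← Nat.add_sub_cancel' hNM, pow_add, ← mul_assoc, hz]
  simp

lemma add (h : IsDyadic N r) (h' : IsDyadic N r') : IsDyadic N (r + r') := by
  obtain ⟨z, hz⟩ := h
  obtain ⟨z', hz'⟩ := h'
  exact ⟨z + z', by rw [add_mul, hz, hz']; simp⟩

lemma sub (h : IsDyadic N r) (h' : IsDyadic N r') : IsDyadic N (r - r') := by
  obtain ⟨z, hz⟩ := h
  obtain ⟨z', hz'⟩ := h'
  exact ⟨z - z', by rw [sub_mul, hz, hz']; simp⟩

lemma mul (h : IsDyadic N r) (h' : IsDyadic M r') : IsDyadic (N + M) (r * r') := by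
  obtain ⟨z, hz⟩ := h
  obtain ⟨z', hz'⟩ := h'
  exact ⟨z * z', by rw [pow_add, mul_mul_mul_comm, hz, hz']; simp⟩

lemma sum {ι : Type*} (A : Finset ι) {g : ι → ℝ} (h : ∀ i, IsDyadic N (g i)) :
    IsDyadic N (∑ i ∈ A, g i) :=
  Finset.sum_induction g (IsDyadic N) (fun _ _ => add) ⟨0, by simp⟩ fun i _ => h i

lemma prod {ι : Type*} (A : Finset ι) {g : ι → ℝ} {e : ι → ℕ} (h : ∀ i, IsDyadic (e i) (g i)) :
    IsDyadic (∑ i ∈ A, e i) (∏ i ∈ A, g i) := by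
  choose z hz using h
  refine ⟨∏ i ∈ A, z i, ?_⟩
  rw [← Finset.prod_pow_eq_pow_sum, ← Finset.prod_mul_distrib]
  simp [hz]

lemma le_abs (h : IsDyadic N r) (hr : r ≠ 0) : 1 / 2 ^ N ≤ |r| := by
  obtain ⟨z, hz⟩ := h
  have hz0 : z ≠ 0 := by
    rintro rfl
    simp [hr] at hz
  have h1 : (1 : ℝ) ≤ |(z : ℝ)| := by exact_mod_cast Int.one_le_abs hz0
  rw [div_le_iff₀ (by positivity)]
  rwa [← hz, abs_mul, abs_of_pos (by positivity : (0 : ℝ) < 2 ^ N)] at h1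

end IsDyadic

lemma isDyadic_one (b : Bool) : IsDyadic 0 (bitCoeff 1 b) := by
  rw [bitCoeff_one]
  split_ifs
  · exact ⟨0, by simp⟩
  · exact ⟨1, by simp⟩

lemma isDyadic_signv (b : Bool) : IsDyadic 0 (bitCoeff signv b) := by
  rw [bitCoeff_signv]
  split_ifs
  · exact ⟨1, by simp⟩
  · exact ⟨0, by simp⟩

lemma isDyadic_bitInd (c b : Bool) : IsDyadic 1 (bitCoeff (bitInd c) b) := by
  rw [bitCoeff_bitInd]
  split_ifs
  · exact ⟨-1, by norm_num⟩
  · exact ⟨1, by norm_num⟩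

lemma isDyadic_prod_factors {t u w : Bool → ℝ} {y z : Fin s → Bool → ℝ} {q : Fin a → Bool → ℝ}
    {l : (Fin a → Bool) → Bool → ℝ} {et eu ew ey ez eq : ℕ} {el : (Fin a → Bool) → ℕ}
    (ht : ∀ b, IsDyadic et (bitCoeff t b)) (hu : ∀ b, IsDyadic eu (bitCoeff u b))
    (hw : ∀ b, IsDyadic ew (bitCoeff w b)) (hy : ∀ i b, IsDyadic ey (bitCoeff (y i) b))
    (hz : ∀ i b, IsDyadic ez (bitCoeff (z i) b)) (hq : ∀ i b, IsDyadic eq (bitCoeff (q i) b))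
    (hl : ∀ i b, IsDyadic (el i) (bitCoeff (l i) b)) (S : Coord p s a m → Bool) :
    IsDyadic (et + (eu + p * ew) + (s * ey + s * ez) + (a * eq + ∑ b, m * el b))
      (∏ i, bitCoeff (factors t u w y z q l i) (S i)) := by
  rw [prod_factors bitCoeff]
  refine (((ht _).mul ((hu _).mul ?_)).mul (.mul ?_ ?_)).mul (.mul ?_ (.prod _ fun b => ?_))
  · simpa using IsDyadic.prod Finset.univ fun i => hw (S (.inl (.inr (.inr i))))
  · simpa using IsDyadic.prod Finset.univ fun i => hy i (S (.inr (.inl (.inl i))))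
  · simpa using IsDyadic.prod Finset.univ fun i => hz i (S (.inr (.inl (.inr i))))
  · simpa using IsDyadic.prod Finset.univ fun i => hq i (S (.inr (.inr (.inl i))))
  · simpa using IsDyadic.prod Finset.univ fun i => hl b (S (.inr (.inr (.inr (b, i)))))

lemma isDyadic_hat_selector (S : Coord p s a m → Bool) {N : ℕ} (h1 : 1 + p + s ≤ N)
    (h2 : a + m ≤ N) : IsDyadic N (hat S (selector p s a m)) := by
  have hone : IsDyadic N (∏ i, bitCoeff 1 (S i)) :=
    (IsDyadic.prod Finset.univ fun i => isDyadic_one (S i)).mono (by simp)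
  have hguard : IsDyadic N (∏ i, bitCoeff (guardFactors i) (S i)) :=
    (isDyadic_prod_factors (el := 0) (isDyadic_bitInd _) isDyadic_one (isDyadic_bitInd _)
      (fun _ => isDyadic_one) (fun _ => isDyadic_one) (fun _ => isDyadic_one)
      (fun _ => isDyadic_one) S).mono (by simp; omega)
  have hinner (v : Fin s → Bool) : IsDyadic N (∏ i, bitCoeff (innerFactors v i) (S i)) :=
    (isDyadic_prod_factors (ez := 0) (el := 0) (isDyadic_bitInd _) isDyadic_signv
      (isDyadic_bitInd _) (fun _ => isDyadic_bitInd _)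
      (fun i b => by
        split_ifs
        · exact isDyadic_signv b
        · exact isDyadic_one b)
      (fun _ => isDyadic_one) (fun _ => isDyadic_one) S).mono (by simp; omega)
  have hblock (b : Fin a → Bool) :
      IsDyadic (1 + a + m) (∏ i, bitCoeff (blockFactors b i) (S i)) :=
    (isDyadic_prod_factors (el := fun b' => if b' = b then 1 else 0) (isDyadic_bitInd _)
      isDyadic_one isDyadic_one (fun _ => isDyadic_one) (fun _ => isDyadic_one)
      (fun _ => isDyadic_bitInd _)
      (fun b' c => by
        split_ifs
        · exact isDyadic_bitInd _ c
        · exact isDyadic_one c) S).mono (by simp; omega)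
  have hblocks : IsDyadic N (2 * ∑ b, ∏ i, bitCoeff (blockFactors b i) (S i)) := by
    obtain ⟨z, hz⟩ := IsDyadic.sum Finset.univ hblock
    refine IsDyadic.mono (N := a + m) ⟨z, ?_⟩ h2
    rw [← hz]
    ring
  rw [hat_selector]
  exact ((hone.sub hguard).add (.sum _ hinner)).sub hblocks

/-- The parameters of the Boolean function `selector p s a m`. -/
lemma exists_selector (p s a m : ℕ) (h : a + m ≤ 1 + p + s) :
    ∃ n, 0 < n ∧ ∃ f : (Fin n → Bool) → ℝ, IsBooleanFunc f ∧
      2 ^ a * m ≤ fourierRank f ∧ fourierRank f ≤ 2 + p + 2 * s + a + 2 ^ a * m ∧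
      2 ^ (1 + p + 2 * s) ≤ sparsity f ∧
      sparsity f ≤ 2 ^ (2 + p + 2 * s) + 2 ^ (1 + 2 * a + m) ∧
      maxSuppEntropy f = 2 ^ (1 + p + s) ∧
      weight f = 1 / 2 ^ (p + 2) + 1 / 2 ^ (m + 1) := by
  have hcard : Fintype.card (Coord p s a m) = 2 + p + 2 * s + a + 2 ^ a * m := by
    simp only [Fintype.card_sum, Fintype.card_unit, Fintype.card_fin, Fintype.card_prod,
      Fintype.card_fun, Fintype.card_bool]
    ring
  have hbool := selector_eq (p := p) (s := s) (a := a) (m := m)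
  have hrank := card_le_fourierRank_relabel (selector p s a m)
    (fun l : (Fin a → Bool) × Fin m => .inr (.inr (.inr l)))
    (Sum.inr_injective.comp (Sum.inr_injective.comp Sum.inr_injective))
    fun l => by convert hat_selector_block_ne_zero l
  refine ⟨Fintype.card (Coord p s a m), Fintype.card_pos, relabel (selector p s a m),
    fun x => hbool _, ?_, (fourierRank_le _).trans_eq hcard, ?_, ?_, ?_, ?_⟩
  · simpa only [Fintype.card_prod, Fintype.card_fun, Fintype.card_bool, Fintype.card_fin]
      using hrank
  · rw [sparsity_relabel]
    exact le_card_support_selector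
  · rw [sparsity_relabel]
    exact card_support_selector_le
  · exact maxSuppEntropy_relabel (by positivity) _
      (abs_hat_selector (S := fun i => decide (i = .inl (.inr (.inl ())))) (by simp) (by simp))
      fun S hS => (isDyadic_hat_selector S le_rfl h).le_abs hS
  · rw [weight_relabel hbool, hat_selector_zero]
    field_simp
    ring

end Selector

/-- The exponents used to choose the parameters of `selector`. -/
lemma exists_exponents {ε : ℝ} (hε : 0 < ε) {ρ κ κ' : ℕ} (hL : 2 / ε ≤ Real.logb 2 κ)
    (hL2 : 2 ≤ Real.logb 2 κ) (hρ : Real.logb 2 κ ≤ ρ) (hρκ : (ρ : ℝ) ≤ (κ : ℝ) ^ ((1 : ℝ) / 2 - ε))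
    (hκ' : (κ : ℝ) ^ ((1 : ℝ) / 2) ≤ κ') (hκ'κ : κ' ≤ κ) :
    ∃ k t a : ℕ, 2 ^ k ≤ κ ∧ κ < 2 ^ (k + 1) ∧ 2 ^ t ≤ κ' ∧ κ' < 2 ^ (t + 1) ∧ 2 ^ a * k ≤ ρ ∧
      ρ < 2 ^ (a + 1) * k ∧ t ≤ k ∧ k ≤ 2 * t + 1 ∧ 2 * a ≤ k ∧ a ≤ t ∧ 2 ≤ k ∧
      (k : ℝ) ≤ Real.logb 2 κ ∧ Real.logb 2 κ ≤ k + 1 ∧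
      ε / 2 * k ≤ (min (k - 2 * a) (t - a) : ℕ) := by
  set L := Real.logb 2 κ with hLdef
  have hκ : 0 < κ := by
    rcases Nat.eq_zero_or_pos κ with rfl | h
    · norm_num [hLdef] at hL2
    · exact h
  have hκR : (0 : ℝ) < κ := by exact_mod_cast hκ
  have hκ'0 : 0 < κ' := by
    have : (0 : ℝ) < κ' := (Real.rpow_pos_of_pos hκR _).trans_le hκ'
    exact_mod_cast this
  have hlog_le {j x : ℕ} (h : 2 ^ j ≤ x) : (j : ℝ) ≤ Real.logb 2 x := by
    have := Real.logb_le_logb_of_le one_lt_two (by positivity)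
      (by exact_mod_cast h : (2 : ℝ) ^ j ≤ x)
    simpa [Real.logb_pow] using this
  have hlog_lt {j x : ℕ} (hx : 0 < x) (h : x < 2 ^ j) : Real.logb 2 x < j := by
    have := Real.logb_lt_logb one_lt_two (by exact_mod_cast hx)
      (by exact_mod_cast h : (x : ℝ) < 2 ^ j)
    simpa [Real.logb_pow] using this
  obtain ⟨k, hk⟩ : ∃ k, k = Nat.log 2 κ := ⟨_, rfl⟩
  obtain ⟨t, ht⟩ : ∃ t, t = Nat.log 2 κ' := ⟨_, rfl⟩
  have hk1 : 2 ^ k ≤ κ := hk ▸ Nat.pow_log_le_self 2 hκ.ne'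
  have hk2 : κ < 2 ^ (k + 1) := hk ▸ Nat.lt_pow_succ_log_self one_lt_two κ
  have ht1 : 2 ^ t ≤ κ' := ht ▸ Nat.pow_log_le_self 2 hκ'0.ne'
  have ht2 : κ' < 2 ^ (t + 1) := ht ▸ Nat.lt_pow_succ_log_self one_lt_two κ'
  have hkL : (k : ℝ) ≤ L := hlog_le hk1
  have hLk : L < k + 1 := by exact_mod_cast hlog_lt hκ hk2
  have hk0 : 2 ≤ k := by
    have : (1 : ℝ) < k := by linarith
    exact_mod_cast this
  have hkρ : k ≤ ρ := by exact_mod_cast hkL.trans hρ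
  obtain ⟨a, ha⟩ : ∃ a, a = Nat.log 2 (ρ / k) := ⟨_, rfl⟩
  have ha1 : 2 ^ a * k ≤ ρ := by
    rw [← Nat.le_div_iff_mul_le (by omega), ha]
    exact Nat.pow_log_le_self 2 (Nat.div_pos hkρ (by omega)).ne'
  have ha2 : ρ < 2 ^ (a + 1) * k := by
    rw [← Nat.div_lt_iff_lt_mul (by omega), ha]
    exact Nat.lt_pow_succ_log_self one_lt_two _
  have haL : (a : ℝ) ≤ (1 / 2 - ε) * L := by
    have hρ0 : (0 : ℝ) < ρ := by exact_mod_cast (by omega : 0 < ρ)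
    have h1 := Real.logb_le_logb_of_le one_lt_two hρ0 hρκ
    rw [Real.logb_rpow_eq_mul_logb_of_pos hκR] at h1
    exact (hlog_le ((Nat.le_mul_of_pos_right _ (by omega)).trans ha1)).trans h1
  have htL : 1 / 2 * L < t + 1 := by
    have h1 := Real.logb_le_logb_of_le one_lt_two (Real.rpow_pos_of_pos hκR _) hκ'
    rw [Real.logb_rpow_eq_mul_logb_of_pos hκR] at h1
    exact h1.trans_lt (by exact_mod_cast hlog_lt hκ'0 ht2)
  have hεL : 2 ≤ ε * L := by rwa [div_le_iff₀' hε] at hL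
  have h2a : 2 * a ≤ k := by
    have : (2 * a : ℝ) ≤ k := by linarith
    exact_mod_cast this
  have hat : a ≤ t := by
    have : (a : ℝ) ≤ t := by linarith
    exact_mod_cast this
  have hεk : ε * k ≤ ε * L := mul_le_mul_of_nonneg_left hkL hε.le
  refine ⟨k, t, a, hk1, hk2, ht1, ht2, ha1, ha2, ?_, ?_, h2a, hat, hk0, hkL, hLk.le, ?_⟩
  · rw [hk, ht]
    exact Nat.log_mono_right hκ'κ
  · have : (k : ℝ) < 2 * t + 2 := by linarith
    have : k < 2 * t + 2 := by exact_mod_cast this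
    omega
  · rw [Nat.cast_min, Nat.cast_sub h2a, Nat.cast_sub hat]
    push_cast
    exact le_min (by linarith) (by linarith)

/-- Comparison of the weight of `selector` with the target weight. -/
lemma weight_bounds {k t a p m : ℕ} {ρ κ κ' L : ℝ} (hk : 0 < k) (hk1 : 2 ^ k ≤ κ)
    (hk2 : κ ≤ 2 ^ (k + 1)) (ht1 : 2 ^ t ≤ κ') (ht2 : κ' ≤ 2 ^ (t + 1)) (ha1 : 2 ^ a * k ≤ ρ)
    (ha2 : ρ ≤ 2 ^ (a + 1) * k) (hL1 : k ≤ L) (hL2 : L ≤ k + 1) (hp1 : 2 * t ≤ p + k)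
    (hp2 : p + k ≤ 2 * t + 1) (hm1 : m + 2 * a ≤ k) (hm2 : m + 2 * a = k ∨ 2 * t ≤ m + k) :
    1 / 16 * max (ρ ^ 2 / (κ * L ^ 2)) (κ / κ' ^ 2) ≤ 1 / 2 ^ (p + 2) + 1 / 2 ^ (m + 1) ∧
      1 / 2 ^ (p + 2) + 1 / 2 ^ (m + 1) ≤ 5 * max (ρ ^ 2 / (κ * L ^ 2)) (κ / κ' ^ 2) := by
  have pow_le {i j : ℕ} (h : i ≤ j) : (2 : ℝ) ^ i ≤ 2 ^ j := pow_le_pow_right₀ one_le_two h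
  have hp1 := pow_le hp1
  have hp2 := pow_le hp2
  have hm1 := pow_le hm1
  have hm2 : (2 : ℝ) ^ (m + 2 * a) = 2 ^ k ∨ (2 : ℝ) ^ (2 * t) ≤ 2 ^ (m + k) :=
    hm2.imp (fun h => by rw [h]) pow_le
  have hkR : (1 : ℝ) ≤ k := by exact_mod_cast hk
  simp only [pow_add, pow_mul', pow_one] at *
  set K : ℝ := 2 ^ k
  set T : ℝ := 2 ^ t
  set A : ℝ := 2 ^ a
  set P : ℝ := 2 ^ p
  set M : ℝ := 2 ^ m
  have hK : 0 < K := by positivity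
  have hT : 0 < T := by positivity
  have hA : 0 < A := by positivity
  have hP : 0 < P := by positivity
  have hM : 0 < M := by positivity
  have hκ : 0 < κ := hK.trans_le hk1
  have hκ' : 0 < κ' := hT.trans_le ht1
  have hL : 0 < L := by linarith
  have hρ : 0 ≤ ρ := le_trans (by positivity) ha1
  set X := ρ ^ 2 / (κ * L ^ 2) with hX
  set Y := κ / κ' ^ 2 with hY
  have hX1 : A ^ 2 / K ≤ 8 * X := by
    calc A ^ 2 / K = 8 * ((A * k) ^ 2 / (K * 2 * (2 * k) ^ 2)) := by field_simp; ring
      _ ≤ 8 * X := by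
        rw [hX]
        gcongr
        linarith
  have hX2 : X ≤ 4 * (A ^ 2 / K) := by
    calc X ≤ (A * 2 * k) ^ 2 / (K * k ^ 2) := by
          rw [hX]
          gcongr
      _ = 4 * (A ^ 2 / K) := by field_simp; ring
  have hY1 : K / T ^ 2 ≤ 4 * Y := by
    calc K / T ^ 2 = 4 * (K / (T * 2) ^ 2) := by field_simp; ring
      _ ≤ 4 * Y := by
        rw [hY]
        gcongr
  have hY2 : Y ≤ 2 * (K / T ^ 2) := by
    calc Y ≤ K * 2 / T ^ 2 := by
          rw [hY]
          gcongr
      _ = 2 * (K / T ^ 2) := by ring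
  have hP1 : 1 / P ≤ K / T ^ 2 := by
    rw [div_le_div_iff₀ hP (by positivity)]
    linarith
  have hP2 : K / T ^ 2 ≤ 2 * (1 / P) := by
    rw [← mul_div_assoc, div_le_div_iff₀ (by positivity) hP]
    linarith
  have hM1 : A ^ 2 / K ≤ 1 / M := by
    rw [div_le_div_iff₀ hK hM]
    linarith
  have hM2 : 1 / M ≤ A ^ 2 / K ∨ 1 / M ≤ K / T ^ 2 := by
    refine hm2.imp (fun h => ?_) fun h => ?_
    · rw [div_le_div_iff₀ hM hK]
      linarith
    · rw [div_le_div_iff₀ hM (by positivity)]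
      linarith
  have eP : 1 / (P * 2 ^ 2) = 1 / P / 4 := by field_simp; norm_num
  have eM : 1 / (M * 2) = 1 / M / 2 := by field_simp
  have hP0 : 0 < 1 / P := by positivity
  have hM0 : 0 < 1 / M := by positivity
  have hXm := le_max_left X Y
  have hYm := le_max_right X Y
  rw [eP, eM]
  constructor
  · rcases max_cases X Y with ⟨h, -⟩ | ⟨h, -⟩ <;> rw [h] <;> linarith
  · rcases hM2 with h | h <;> linarith

/-- **Theorem (tightness in terms of `k'`).** For every constant `ε > 0` there are
constants `c₁, …, c₈ > 0` and `κ₀` so that for all `ρ, κ, κ'` with `κ ≥ κ₀`,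
`log₂ κ ≤ ρ ≤ κ^{1/2-ε}` and `κ^{1/2} ≤ κ' ≤ κ`, there is a Boolean function with
`r = Θ(ρ)`, `k = Θ(κ)`, `k' = Θ(κ')` and
`δ = Θ(max{ρ²/(κ log₂²κ), κ/κ'²})`. -/
theorem tightness_k' (ε : ℝ) (hε : 0 < ε) :
    ∃ c₁ c₂ c₃ c₄ c₅ c₆ c₇ c₈ : ℝ,
      0 < c₁ ∧ 0 < c₂ ∧ 0 < c₃ ∧ 0 < c₄ ∧ 0 < c₅ ∧ 0 < c₆ ∧ 0 < c₇ ∧ 0 < c₈ ∧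
      ∃ κ₀ : ℕ, ∀ ρ κ κ' : ℕ,
        κ₀ ≤ κ →
        Real.logb 2 (κ : ℝ) ≤ (ρ : ℝ) →
        (ρ : ℝ) ≤ (κ : ℝ) ^ ((1 : ℝ) / 2 - ε) →
        (κ : ℝ) ^ ((1 : ℝ) / 2) ≤ (κ' : ℝ) → κ' ≤ κ →
        ∃ (n : ℕ), 0 < n ∧ ∃ f : (Fin n → Bool) → ℝ, IsBooleanFunc f ∧
          c₁ * ρ ≤ (fourierRank f : ℝ) ∧ (fourierRank f : ℝ) ≤ c₂ * ρ ∧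
          c₃ * κ ≤ (sparsity f : ℝ) ∧ (sparsity f : ℝ) ≤ c₄ * κ ∧
          c₅ * κ' ≤ maxSuppEntropy f ∧ maxSuppEntropy f ≤ c₆ * κ' ∧
          c₇ * max ((ρ : ℝ) ^ 2 / ((κ : ℝ) * (Real.logb 2 (κ : ℝ)) ^ 2))
              ((κ : ℝ) / (κ' : ℝ) ^ 2) ≤ weight f ∧
          weight f ≤
            c₈ * max ((ρ : ℝ) ^ 2 / ((κ : ℝ) * (Real.logb 2 (κ : ℝ)) ^ 2))
              ((κ : ℝ) / (κ' : ℝ) ^ 2) := by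
  refine ⟨ε / 4, 4, 1 / 2, 6, 1, 2, 1 / 16, 5, by positivity, by norm_num, by norm_num,
    by norm_num, by norm_num, by norm_num, by norm_num, by norm_num,
    ⌈(2 : ℝ) ^ max (2 / ε) 2⌉₊, fun ρ κ κ' hκ hρ hρκ hκ' hκ'κ => ?_⟩
  have hκL : max (2 / ε) 2 ≤ Real.logb 2 κ := by
    have h := Nat.ceil_le.mp hκ
    rwa [Real.le_logb_iff_rpow_le one_lt_two ((Real.rpow_pos_of_pos two_pos _).trans_le h)]
  obtain ⟨k, t, a, hk1, hk2, ht1, ht2, ha1, ha2, htk, hkt, hak, hat, hk0, hkL, hLk, hm⟩ :=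
    exists_exponents hε ((le_max_left _ _).trans hκL) ((le_max_right _ _).trans hκL) hρ hρκ
      hκ' hκ'κ
  obtain ⟨s, hs⟩ : ∃ s, s = min (k - t) t := ⟨_, rfl⟩
  obtain ⟨p, hp⟩ : ∃ p, p = t - s := ⟨_, rfl⟩
  obtain ⟨m, hm'⟩ : ∃ m, m = min (k - 2 * a) (t - a) := ⟨_, rfl⟩
  rw [← hm'] at hm
  obtain ⟨n, hn, f, hf, hr1, hr2, hs1, hs2, hK, hW⟩ := exists_selector p s a m (by omega)
  have pow_le {i j : ℕ} (h : i ≤ j) : 2 ^ i ≤ 2 ^ j := Nat.pow_le_pow_right two_pos h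
  have hmk : 2 ^ a * m ≤ ρ := (Nat.mul_le_mul_left _ (by omega : m ≤ k)).trans ha1
  have hkρ : k ≤ ρ := (Nat.le_mul_of_pos_left _ (by positivity)).trans ha1
  have ht1' : (2 : ℝ) ^ t ≤ κ' := by exact_mod_cast ht1
  have ht2' : (κ' : ℝ) ≤ 2 ^ (t + 1) := by exact_mod_cast ht2.le
  rw [(by omega : 1 + p + s = t + 1)] at hK
  refine ⟨n, hn, f, hf, ?_, ?_, ?_, ?_, ?_, ?_, ?_⟩
  · have h2 : (2 : ℝ) ^ a * m ≤ fourierRank f := by exact_mod_cast hr1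
    have h3 : (ρ : ℝ) ≤ 2 ^ (a + 1) * k := by exact_mod_cast ha2.le
    calc ε / 4 * ρ ≤ ε / 4 * (2 ^ (a + 1) * k) := by gcongr
      _ = 2 ^ a * (ε / 2 * k) := by ring
      _ ≤ 2 ^ a * m := by gcongr
      _ ≤ _ := h2
  · have : fourierRank f ≤ 4 * ρ := by omega
    exact_mod_cast this
  · have h := (pow_le (by omega : k ≤ 1 + p + 2 * s)).trans hs1
    rw [pow_succ] at hk2
    have h' : κ ≤ 2 * sparsity f := by omega
    have : (κ : ℝ) ≤ 2 * sparsity f := by exact_mod_cast h'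
    linarith
  · have h1 := pow_le (by omega : 2 + p + 2 * s ≤ k + 2)
    have h2 := pow_le (by omega : 1 + 2 * a + m ≤ k + 1)
    rw [pow_add _ k] at h1 h2
    have : sparsity f ≤ 6 * κ := by omega
    exact_mod_cast this
  · rw [hK]
    linarith
  · rw [hK, pow_succ]
    linarith
  · rw [hW]
    exact weight_bounds (by omega) (by exact_mod_cast hk1) (by exact_mod_cast hk2.le) ht1' ht2'
      (by exact_mod_cast ha1) (by exact_mod_cast ha2.le) hkL hLk (by omega) (by omega) (by omega)
      (by omega)

end BoolFunc

end
end
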